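/- There exist positive constants ε₃ and C depending only on λ, Λ, K, C₀ and d, such that: for any 0 < r ≤ 1 and 0 < l ≤ 1, any f ∈ L^d(B_{2l}) ∩ C(B_{2l}), and any nonnegative bounded lower semicontinuous function u that is a viscosity supersolution of −P⁻(D²u) − P⁻_{K,r}(u) + C₀ r |Du| ≥ f in the ball B_{2l}, one has for every t > 0 the Lebesgue-measure estimate |{x ∈ B_l : u(x) > t}| ≤ C l^d (inf_{B_l} u + l ‖f‖_{L^d(B_{2l})})^{ε₃} t^{−ε₃}. -/

import Mathlib

open MeasureTheory Metric Set
open scoped RealInnerProductSpace ENNReal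

noncomputable section

/-- `d`-dimensional Euclidean space. -/
abbrev Ed (d : ℕ) : Type := EuclideanSpace ℝ (Fin d)

/-- A real-valued function on `ℝ^d` is bounded. -/
def IsBddFun {d : ℕ} (φ : Ed d → ℝ) : Prop := ∃ M, ∀ x, |φ x| ≤ M

/-- The open cube of half side length `δ` centered at `x`. -/
def cubeAt {d : ℕ} (x : Ed d) (δ : ℝ) : Set (Ed d) := {y | ∀ i, |y i - x i| < δ}

/-- The open cube `Q_δ = (-δ, δ)^d`. -/
def cube (d : ℕ) (δ : ℝ) : Set (Ed d) := cubeAt 0 δ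

/-- Hessian matrix of `φ` at `x` (matrix of second derivatives). -/
def hess {d : ℕ} (φ : Ed d → ℝ) (x : Ed d) : Matrix (Fin d) (Fin d) ℝ :=
  Matrix.of fun i j =>
    iteratedFDeriv ℝ 2 φ x ![EuclideanSpace.single i (1 : ℝ), EuclideanSpace.single j (1 : ℝ)]

/-- Symmetric matrices `A` with `λ I ≤ A ≤ Λ I`. -/
def ellipticSet (lam Lam : ℝ) (d : ℕ) : Set (Matrix (Fin d) (Fin d) ℝ) :=
  {A | A.IsSymm ∧ (A - lam • (1 : Matrix (Fin d) (Fin d) ℝ)).PosSemidef ∧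
      (Lam • (1 : Matrix (Fin d) (Fin d) ℝ) - A).PosSemidef}

/-- The Pucci maximal operator `P⁺`. -/
def pucciPlus {d : ℕ} (lam Lam : ℝ) (X : Matrix (Fin d) (Fin d) ℝ) : ℝ :=
  sSup ((fun A => (A * X).trace) '' ellipticSet lam Lam d)

/-- The Pucci minimal operator `P⁻`. -/
def pucciMinus {d : ℕ} (lam Lam : ℝ) (X : Matrix (Fin d) (Fin d) ℝ) : ℝ :=
  sInf ((fun A => (A * X).trace) '' ellipticSet lam Lam d)

/-- The Lévy kernel condition: `K ≥ 0` measurable with `∫ min(|z|²,1) K(z) dz < ∞`. -/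
def KernCond {d : ℕ} (K : Ed d → ℝ) : Prop :=
  Measurable K ∧ (∀ z, 0 ≤ K z) ∧ Integrable (fun z : Ed d => min (‖z‖ ^ 2) 1 * K z)

/-- The rescaled kernel `K_r(z) = r^{d+2} K(rz)`. -/
def Kresc {d : ℕ} (K : Ed d → ℝ) (r : ℝ) (z : Ed d) : ℝ := r ^ (d + 2) * K (r • z)

/-- The second-order increment `u(x+z) − u(x) − 1_{B_{1/r}}(z) Du(x)·z`. -/
def deltaOp {d : ℕ} (φ : Ed d → ℝ) (r : ℝ) (x z : Ed d) : ℝ :=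
  φ (x + z) - φ x - (Metric.ball (0 : Ed d) (1 / r)).indicator (fun w => ⟪gradient φ x, w⟫) z

/-- The maximal nonlocal Pucci operator `P⁺_{K,r}`. -/
def nlPlus {d : ℕ} (K : Ed d → ℝ) (r : ℝ) (φ : Ed d → ℝ) (x : Ed d) : ℝ :=
  ∫ z, max (deltaOp φ r x z) 0 * Kresc K r z

/-- The minimal nonlocal Pucci operator `P⁻_{K,r}`. -/
def nlMinus {d : ℕ} (K : Ed d → ℝ) (r : ℝ) (φ : Ed d → ℝ) (x : Ed d) : ℝ :=
  -∫ z, max (-deltaOp φ r x z) 0 * Kresc K r z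

/-- Viscosity supersolution of `−P⁻(D²u) − P⁻_{K,r}(u) + C₀ r |Du| ≥ f` in `O`. -/
def SupersolExtremal {d : ℕ} (lam Lam C0 r : ℝ) (K f : Ed d → ℝ) (O : Set (Ed d))
    (u : Ed d → ℝ) : Prop :=
  ∀ φ : Ed d → ℝ, ContDiff ℝ 2 φ → IsBddFun φ → ∀ x ∈ O, (∀ y, φ y ≤ u y) → u x = φ x →
    f x ≤ -pucciMinus lam Lam (hess φ x) - nlMinus K r φ x + C0 * r * ‖gradient φ x‖

/-- Viscosity subsolution of `P⁺(D²u) + P⁺_K(u) + C₀|Du| ≥ g` in `O`. -/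
def SubsolPlus {d : ℕ} (lam Lam C0 : ℝ) (K g : Ed d → ℝ) (O : Set (Ed d)) (u : Ed d → ℝ) : Prop :=
  ∀ φ : Ed d → ℝ, ContDiff ℝ 2 φ → IsBddFun φ → ∀ x ∈ O, (∀ y, u y ≤ φ y) → u x = φ x →
    g x ≤ pucciPlus lam Lam (hess φ x) + nlPlus K 1 φ x + C0 * ‖gradient φ x‖

/-- Viscosity supersolution of `P⁻(D²u) + P⁻_K(u) − C₀|Du| ≤ g` in `O`. -/
def SupersolMinus {d : ℕ} (lam Lam C0 : ℝ) (K g : Ed d → ℝ) (O : Set (Ed d)) (u : Ed d → ℝ) : Prop :=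
  ∀ φ : Ed d → ℝ, ContDiff ℝ 2 φ → IsBddFun φ → ∀ x ∈ O, (∀ y, φ y ≤ u y) → u x = φ x →
    pucciMinus lam Lam (hess φ x) + nlMinus K 1 φ x - C0 * ‖gradient φ x‖ ≤ g x

/-- Negative part `f⁻ = −min{f,0}`. -/
def nPart {d : ℕ} (f : Ed d → ℝ) : Ed d → ℝ := fun x => max (-f x) 0

/-- Positive part `f⁺ = max{f,0}`. -/
def pPart {d : ℕ} (f : Ed d → ℝ) : Ed d → ℝ := fun x => max (f x) 0

/-- The `L^p` norm of `f` on a set `S`. -/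
def LnormOn {d : ℕ} (p : ℝ) (S : Set (Ed d)) (f : Ed d → ℝ) : ℝ :=
  (∫ x in S, |f x| ^ p) ^ (1 / p)

/-- The nonlocal contact set `Γ^{n,−}_O(v)`. -/
def nContact {d : ℕ} (O : Set (Ed d)) (v : Ed d → ℝ) : Set (Ed d) :=
  {x | x ∈ O ∧ v x < sInf (v '' Oᶜ) ∧
      ∃ p : Ed d, ∀ y, Metric.infDist y O < Metric.diam O → v x + ⟪p, y - x⟫ ≤ v y}

/-- The set `G^u_M` of points where `u` is touched from below by a paraboloid of opening `M`. -/
def GSet {d : ℕ} (u : Ed d → ℝ) (M : ℝ) : Set (Ed d) :=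
  {x | ∃ ρ > 0, ∃ A C : ℝ, ∃ B : Ed d, |A| + ‖B‖ + |C| ≤ M ∧ u x = A ∧
      ∀ y ∈ Metric.ball x ρ, A + ⟪B, y - x⟫ - C / 2 * ‖y - x‖ ^ 2 ≤ u y}

/-- The bad set `B^u_M`. -/
def BSet {d : ℕ} (u : Ed d → ℝ) (M : ℝ) : Set (Ed d) := (GSet u M)ᶜ

/-- Upper semicontinuous envelope `u*`. -/
def usEnv {d : ℕ} (u : Ed d → ℝ) (x : Ed d) : ℝ :=
  ⨅ ρ : {ρ : ℝ // 0 < ρ}, ⨆ y : {y : Ed d // ‖y - x‖ ≤ ρ.1}, u y.1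

/-- Lower semicontinuous envelope `u_*`. -/
def lsEnv {d : ℕ} (u : Ed d → ℝ) (x : Ed d) : ℝ :=
  ⨆ ρ : {ρ : ℝ // 0 < ρ}, ⨅ y : {y : Ed d // ‖y - x‖ ≤ ρ.1}, u y.1

/-- A modulus of continuity. -/
def IsModulus (m : ℝ → ℝ) : Prop :=
  (∀ t, 0 ≤ m t) ∧ Monotone m ∧ m 0 = 0 ∧ ContinuousAt m 0

/-- The uniform exterior ball condition. -/
def ExtBallCond {d : ℕ} (Ω : Set (Ed d)) : Prop :=
  ∃ ρ > 0, ∀ ξ ∈ frontier Ω, ∃ y ∈ Ωᶜ, Metric.ball y ρ ⊆ Ωᶜ ∧ ξ ∈ Metric.sphere y ρ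

section HJBI

variable {d : ℕ} {𝒜 ℬ : Type}

/-- The linear nonlocal operator `I_{ab}[x, φ]`. -/
def Iop (N : 𝒜 → ℬ → Ed d → Ed d → ℝ) (a : 𝒜) (b : ℬ) (φ : Ed d → ℝ) (x : Ed d) : ℝ :=
  ∫ z, (φ (x + z) - φ x -
      (Metric.ball (0 : Ed d) 1).indicator (fun w => ⟪gradient φ x, w⟫) z) * N a b x z

/-- The HJBI operator evaluated at `φ`, with the zeroth order slot evaluated at `s`. -/
def HJBIat (aM : 𝒜 → ℬ → Ed d → Matrix (Fin d) (Fin d) ℝ) (bV : 𝒜 → ℬ → Ed d → Ed d)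
    (cF fF : 𝒜 → ℬ → Ed d → ℝ) (N : 𝒜 → ℬ → Ed d → Ed d → ℝ)
    (φ : Ed d → ℝ) (s : ℝ) (x : Ed d) : ℝ :=
  ⨆ a, ⨅ b, (-(aM a b x * hess φ x).trace - Iop N a b φ x +
    ⟪bV a b x, gradient φ x⟫ + cF a b x * s + fF a b x)

/-- The HJBI operator `ℐφ(x)`. -/
def HJBIop (aM : 𝒜 → ℬ → Ed d → Matrix (Fin d) (Fin d) ℝ) (bV : 𝒜 → ℬ → Ed d → Ed d)
    (cF fF : 𝒜 → ℬ → Ed d → ℝ) (N : 𝒜 → ℬ → Ed d → Ed d → ℝ)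
    (φ : Ed d → ℝ) (x : Ed d) : ℝ :=
  HJBIat aM bV cF fF N φ (φ x) x

/-- Viscosity subsolution of `ℐu = 0` in `Ω` (test function formulation). -/
def SubsolHJBI (aM : 𝒜 → ℬ → Ed d → Matrix (Fin d) (Fin d) ℝ) (bV : 𝒜 → ℬ → Ed d → Ed d)
    (cF fF : 𝒜 → ℬ → Ed d → ℝ) (N : 𝒜 → ℬ → Ed d → Ed d → ℝ) (Ω : Set (Ed d))
    (u : Ed d → ℝ) : Prop :=
  ∀ φ : Ed d → ℝ, ContDiff ℝ 2 φ → IsBddFun φ → ∀ x ∈ Ω, (∀ y, u y ≤ φ y) → u x = φ x →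
    HJBIop aM bV cF fF N φ x ≤ 0

/-- Viscosity supersolution of `ℐu = 0` in `Ω` (test function formulation). -/
def SupersolHJBI (aM : 𝒜 → ℬ → Ed d → Matrix (Fin d) (Fin d) ℝ) (bV : 𝒜 → ℬ → Ed d → Ed d)
    (cF fF : 𝒜 → ℬ → Ed d → ℝ) (N : 𝒜 → ℬ → Ed d → Ed d → ℝ) (Ω : Set (Ed d))
    (u : Ed d → ℝ) : Prop :=
  ∀ φ : Ed d → ℝ, ContDiff ℝ 2 φ → IsBddFun φ → ∀ x ∈ Ω, (∀ y, φ y ≤ u y) → u x = φ x →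
    0 ≤ HJBIop aM bV cF fF N φ x

/-- Uniform ellipticity of the HJBI operator `ℐ`. -/
def UnifElliptic (lam Lam C0 : ℝ) (K : Ed d → ℝ) (Ω : Set (Ed d))
    (aM : 𝒜 → ℬ → Ed d → Matrix (Fin d) (Fin d) ℝ) (bV : 𝒜 → ℬ → Ed d → Ed d)
    (cF fF : 𝒜 → ℬ → Ed d → ℝ) (N : 𝒜 → ℬ → Ed d → Ed d → ℝ) : Prop :=
  ∃ m : ℝ → ℝ, IsModulus m ∧
    ∀ r s : ℝ, ∀ x ∈ Ω, ∀ φ ψ : Ed d → ℝ,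
      ContDiff ℝ 2 φ → IsBddFun φ → ContDiff ℝ 2 ψ → IsBddFun ψ →
      (pucciMinus lam Lam (hess (fun y => φ y - ψ y) x) + nlMinus K 1 (fun y => φ y - ψ y) x -
          C0 * ‖gradient (fun y => ψ y - φ y) x‖ - m |r - s| ≤
        HJBIat aM bV cF fF N ψ r x - HJBIat aM bV cF fF N φ s x) ∧
      (HJBIat aM bV cF fF N ψ r x - HJBIat aM bV cF fF N φ s x ≤
        pucciPlus lam Lam (hess (fun y => φ y - ψ y) x) + nlPlus K 1 (fun y => φ y - ψ y) x +
          C0 * ‖gradient (fun y => ψ y - φ y) x‖ + m |r - s|)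

/-- Boundedness of the coefficient families, uniformly in `a, b`. -/
def FamiliesBdd (Ω : Set (Ed d)) (aM : 𝒜 → ℬ → Ed d → Matrix (Fin d) (Fin d) ℝ)
    (bV : 𝒜 → ℬ → Ed d → Ed d) (cF fF : 𝒜 → ℬ → Ed d → ℝ) : Prop :=
  ∃ Cb : ℝ, ∀ a b, ∀ x ∈ Ω, (∀ i j, |aM a b x i j| ≤ Cb) ∧ ‖bV a b x‖ ≤ Cb ∧
      |cF a b x| ≤ Cb ∧ |fF a b x| ≤ Cb

/-- Uniform continuity of the coefficient families with a common modulus, uniformly in `a, b, z`. -/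
def FamiliesUC (Ω : Set (Ed d)) (aM : 𝒜 → ℬ → Ed d → Matrix (Fin d) (Fin d) ℝ)
    (bV : 𝒜 → ℬ → Ed d → Ed d) (cF fF : 𝒜 → ℬ → Ed d → ℝ)
    (N : 𝒜 → ℬ → Ed d → Ed d → ℝ) : Prop :=
  ∃ m₀ : ℝ → ℝ, IsModulus m₀ ∧ ∀ a b, ∀ x ∈ Ω, ∀ y ∈ Ω,
      (∀ i j, |aM a b x i j - aM a b y i j| ≤ m₀ ‖x - y‖) ∧
      ‖bV a b x - bV a b y‖ ≤ m₀ ‖x - y‖ ∧ |cF a b x - cF a b y| ≤ m₀ ‖x - y‖ ∧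
      |fF a b x - fF a b y| ≤ m₀ ‖x - y‖ ∧ ∀ z, |N a b x z - N a b y z| ≤ m₀ ‖x - y‖

end HJBI

/-- Comparison weight for the nonlocal operator. -/
def kfun {d : ℕ} (s : ℝ) (w : Ed d) : ℝ :=
  if ‖w‖ < 1 then min (‖w‖ ^ 2) (2 * s * ‖w‖) else s ^ 2

lemma kfun_nonneg {d : ℕ} {s : ℝ} (hs : 0 ≤ s) (w : Ed d) : 0 ≤ kfun s w := by
  unfold kfun
  split_ifs <;> positivity

lemma kfun_mono {d : ℕ} {s s' : ℝ} (hs : 0 ≤ s) (h : s ≤ s') (w : Ed d) :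
    kfun s w ≤ kfun s' w := by
  unfold kfun
  split_ifs
  · apply min_le_min le_rfl
    gcongr
  · gcongr

lemma kfun_le {d : ℕ} {s : ℝ} (hs : 0 ≤ s) (h1 : s ≤ 1) (w : Ed d) :
    kfun s w ≤ min (‖w‖ ^ 2) 1 := by
  unfold kfun
  split_ifs with h
  · refine le_min (min_le_left _ _) ((min_le_left _ _).trans ?_)
    exact pow_le_one₀ (norm_nonneg _) h.le
  · push Not at h
    have : s ^ 2 ≤ 1 := pow_le_one₀ hs h1
    refine le_min (this.trans (one_le_pow₀ h)) this

lemma kfun_measurable {d : ℕ} (s : ℝ) : Measurable (kfun (d := d) s) := by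
  unfold kfun
  refine Measurable.ite ?_ ?_ measurable_const
  · exact measurableSet_lt measurable_norm measurable_const
  · fun_prop

/-- The integrated weight. -/
def sig {d : ℕ} (K : Ed d → ℝ) (s : ℝ) : ℝ := ∫ w, kfun s w * K w

lemma sig_integrable {d : ℕ} {K : Ed d → ℝ} (hK : KernCond K) {s : ℝ} (hs : 0 ≤ s) (h1 : s ≤ 1) :
    Integrable (fun w => kfun s w * K w) := by
  obtain ⟨hm, hn, hi⟩ := hK
  refine hi.mono' ((kfun_measurable s).mul hm).aestronglyMeasurable ?_
  filter_upwards with w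
  rw [Real.norm_of_nonneg (mul_nonneg (kfun_nonneg hs w) (hn w))]
  exact mul_le_mul_of_nonneg_right (kfun_le hs h1 w) (hn w)

lemma sig_nonneg {d : ℕ} {K : Ed d → ℝ} (hK : KernCond K) {s : ℝ} (hs : 0 ≤ s) : 0 ≤ sig K s :=
  integral_nonneg fun w => mul_nonneg (kfun_nonneg hs w) (hK.2.1 w)

lemma sig_mono {d : ℕ} {K : Ed d → ℝ} (hK : KernCond K) {s s' : ℝ} (hs : 0 ≤ s) (h : s ≤ s')
    (h1 : s' ≤ 1) : sig K s ≤ sig K s' := by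
  apply integral_mono (sig_integrable hK hs (h.trans h1)) (sig_integrable hK (hs.trans h) h1)
  intro w
  exact mul_le_mul_of_nonneg_right (kfun_mono hs h w) (hK.2.1 w)

lemma sig_small {d : ℕ} {K : Ed d → ℝ} (hK : KernCond K) {δ : ℝ} (hδ : 0 < δ) :
    ∃ r0 : ℝ, 0 < r0 ∧ r0 ≤ 1 ∧ r0 ≤ δ ∧ sig K r0 ≤ δ := by
  have hlim : Filter.Tendsto (fun n : ℕ => sig K (1 / ((n : ℝ) + 1))) Filter.atTop
      (nhds (∫ _w : Ed d, (0 : ℝ))) := by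
    have hb : ∀ n : ℕ, (0:ℝ) ≤ 1 / ((n : ℝ) + 1) ∧ 1 / ((n : ℝ) + 1) ≤ 1 := by
      intro n
      constructor
      · positivity
      · rw [div_le_one (by positivity)]
        linarith [(Nat.cast_nonneg n : (0:ℝ) ≤ n)]
    refine tendsto_integral_of_dominated_convergence (fun z => min (‖z‖ ^ 2) 1 * K z)
      (fun n => ((kfun_measurable _).mul hK.1).aestronglyMeasurable) hK.2.2 ?_ ?_
    · intro n
      filter_upwards with w
      rw [Real.norm_of_nonneg (mul_nonneg (kfun_nonneg (hb n).1 w) (hK.2.1 w))]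
      exact mul_le_mul_of_nonneg_right (kfun_le (hb n).1 (hb n).2 w) (hK.2.1 w)
    · filter_upwards with w
      have h0 : Filter.Tendsto (fun n : ℕ => 1 / ((n : ℝ) + 1)) Filter.atTop (nhds 0) :=
        tendsto_one_div_add_atTop_nhds_zero_nat
      have : Filter.Tendsto (fun n : ℕ => kfun (1 / ((n : ℝ) + 1)) w) Filter.atTop (nhds 0) := by
        unfold kfun
        split_ifs with h
        · have h2 : Filter.Tendsto (fun n : ℕ => 2 * (1 / ((n : ℝ) + 1)) * ‖w‖) Filter.atTop
              (nhds (2 * 0 * ‖w‖)) := (h0.const_mul 2).mul_const _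
          rw [mul_zero, zero_mul] at h2
          refine squeeze_zero (fun n => ?_) (fun n => min_le_right _ _) h2
          have := (hb n).1
          positivity
        · have := h0.pow 2
          simpa using this
      simpa using this.mul_const (K w)
  simp only [integral_zero] at hlim
  have h0 : Filter.Tendsto (fun n : ℕ => 1 / ((n : ℝ) + 1)) Filter.atTop (nhds 0) :=
        tendsto_one_div_add_atTop_nhds_zero_nat
  obtain ⟨n, hn, hn'⟩ := ((hlim.eventually (gt_mem_nhds hδ)).and
    (h0.eventually (gt_mem_nhds hδ))).exists
  refine ⟨1 / ((n : ℝ) + 1), by positivity, ?_, hn'.le, hn.le⟩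
  rw [div_le_one (by positivity)]
  linarith [(Nat.cast_nonneg n : (0:ℝ) ≤ n)]

lemma integral_kfun_Kresc {d : ℕ} (K : Ed d → ℝ) {r : ℝ} (hr : 0 < r) (s : ℝ) :
    ∫ z, kfun s (r • z) * Kresc K r z = r ^ 2 * sig K s := by
  have h := Measure.integral_comp_smul (volume : Measure (Ed d)) (fun w => kfun s w * K w) r
  have e : (fun z : Ed d => kfun s (r • z) * Kresc K r z) =
      fun z => r ^ (d + 2) * ((fun w => kfun s w * K w) (r • z)) := by
    funext z
    simp only [Kresc]
    ring
  rw [e, integral_const_mul, h, sig]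
  simp only [finrank_euclideanSpace, Fintype.card_fin, smul_eq_mul]
  rw [abs_of_pos (by positivity)]
  field_simp
  ring

lemma integrable_kfun_Kresc {d : ℕ} {K : Ed d → ℝ} (hK : KernCond K) {r : ℝ} (hr : 0 < r) {s : ℝ}
    (hs : 0 ≤ s) (h1 : s ≤ 1) :
    Integrable (fun z => kfun s (r • z) * Kresc K r z) := by
  have h := (sig_integrable hK hs h1).comp_smul hr.ne'
  refine (h.const_mul (r ^ (d + 2))).congr ?_
  filter_upwards with z
  simp only [Kresc]
  ring

lemma Kresc_nonneg {d : ℕ} {K : Ed d → ℝ} (hK : KernCond K) {r : ℝ} (hr : 0 < r) (z : Ed d) :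
    0 ≤ Kresc K r z := mul_nonneg (by positivity) (hK.2.1 _)

/-- Upper bound for the nonlocal term. -/
lemma nlMinus_bound {d : ℕ} {K : Ed d → ℝ} (hK : KernCond K) {r ρ : ℝ} (hr : 0 < r) (hr1 : r ≤ 1)
    (hρ : 0 < ρ) (hρ1 : ρ ≤ 1) {M1 M2 : ℝ} (hM1 : 0 ≤ M1) (hM2 : 0 ≤ M2)
    {φ : Ed d → ℝ} {x : Ed d}
    (h : ∀ z, -deltaOp φ r x z ≤ M1 / r ^ 2 * kfun r (r • z) +
      M2 / (r * ρ) ^ 2 * kfun (r * ρ) (r • z)) :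
    -nlMinus K r φ x ≤ M1 * sig K r + M2 / ρ ^ 2 * sig K (r * ρ) := by
  have hs : r * ρ ≤ 1 := mul_le_one₀ hr1 hρ.le hρ1
  have hs0 : 0 < r * ρ := by positivity
  unfold nlMinus
  rw [neg_neg]
  have i1 := integrable_kfun_Kresc hK hr hr.le hr1
  have i2 := integrable_kfun_Kresc hK hr hs0.le hs
  have e : M1 * sig K r + M2 / ρ ^ 2 * sig K (r * ρ) =
      ∫ z, (M1 / r ^ 2 * (kfun r (r • z) * Kresc K r z) +
        M2 / (r * ρ) ^ 2 * (kfun (r * ρ) (r • z) * Kresc K r z)) := by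
    rw [integral_add (i1.const_mul _) (i2.const_mul _), integral_const_mul, integral_const_mul,
      integral_kfun_Kresc K hr, integral_kfun_Kresc K hr]
    field_simp
  rw [e]
  apply integral_mono_of_nonneg
  · filter_upwards with z
    exact mul_nonneg (le_max_right _ _) (Kresc_nonneg hK hr z)
  · exact (i1.const_mul _).add (i2.const_mul _)
  · filter_upwards with z
    have h1 : max (-deltaOp φ r x z) 0 ≤ M1 / r ^ 2 * kfun r (r • z) +
      M2 / (r * ρ) ^ 2 * kfun (r * ρ) (r • z) := by
      refine max_le (h z) ?_
      have := kfun_nonneg hr.le (r • z)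
      have := kfun_nonneg hs0.le (r • z)
      positivity
    calc _ ≤ _ := mul_le_mul_of_nonneg_right h1 (Kresc_nonneg hK hr z)
      _ = _ := by ring

/-- Increment bound in terms of `kfun`. -/
lemma incr_bound {d : ℕ} {r ρ M : ℝ} (hr : 0 < r) (hρ : 0 < ρ) (hM : 0 ≤ M)
    {D : ℝ} {v z : Ed d} (h1 : -M ≤ D) (h2 : ‖v‖ ≤ M / ρ)
    (h3 : -(M / ρ ^ 2 * ‖z‖ ^ 2) ≤ D - ⟪v, z⟫) :
    -(D - (Metric.ball (0 : Ed d) (1 / r)).indicator (fun w => ⟪v, w⟫) z) ≤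
      M / (r * ρ) ^ 2 * kfun (r * ρ) (r • z) := by
  have hn : ‖r • z‖ = r * ‖z‖ := by rw [norm_smul, Real.norm_of_nonneg hr.le]
  unfold kfun
  by_cases hz : ‖z‖ < 1 / r
  · have hz' : r * ‖z‖ < 1 := by
      rw [lt_div_iff₀ hr] at hz; linarith
    rw [indicator_of_mem (by simpa using hz), hn, if_pos hz']
    have hb1 : -(D - ⟪v, z⟫) ≤ M / (r * ρ) ^ 2 * (r * ‖z‖) ^ 2 := by
      have : M / (r * ρ) ^ 2 * (r * ‖z‖) ^ 2 = M / ρ ^ 2 * ‖z‖ ^ 2 := by field_simp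
      linarith
    rcases le_total ((r * ‖z‖) ^ 2) (2 * (r * ρ) * (r * ‖z‖)) with hc | hc
    · rw [min_eq_left hc]; exact hb1
    · rw [min_eq_right hc]
      have e : M / (r * ρ) ^ 2 * (2 * (r * ρ) * (r * ‖z‖)) = 2 * (M / ρ * ‖z‖) := by field_simp
      rw [e]
      have hin : ⟪v, z⟫ ≤ M / ρ * ‖z‖ :=
        (real_inner_le_norm v z).trans (mul_le_mul_of_nonneg_right h2 (norm_nonneg _))
      rcases (norm_nonneg z).eq_or_lt with h0 | h0
      · have : z = 0 := by simpa using h0.symm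
        subst this
        simp at h3 ⊢
        linarith
      · have : 2 * ρ ≤ ‖z‖ := by
          by_contra hcon
          push Not at hcon
          have : (r * ‖z‖) ^ 2 < 2 * (r * ρ) * (r * ‖z‖) := by
            have : r ^ 2 * ‖z‖ * ‖z‖ < r ^ 2 * ‖z‖ * (2 * ρ) :=
              mul_lt_mul_of_pos_left hcon (by positivity)
            nlinarith
          linarith
        have : M ≤ M / ρ * ‖z‖ := by
          rw [div_mul_eq_mul_div, le_div_iff₀ hρ]
          exact mul_le_mul_of_nonneg_left (by linarith) hM
        linarith
  · push Not at hz
    have hz' : ¬ r * ‖z‖ < 1 := by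
      push Not
      rw [div_le_iff₀ hr] at hz; linarith
    rw [indicator_of_notMem (by simpa using hz), hn, if_neg hz']
    have : M / (r * ρ) ^ 2 * (r * ρ) ^ 2 = M := by field_simp
    linarith

/-- Lower bound for the Pucci operator. -/
lemma pucci_bound {d : ℕ} {lam Lam : ℝ} (hLam : lam ≤ Lam)
    {X : Matrix (Fin d) (Fin d) ℝ} {v w : Ed d} {c1 c2 c3 : ℝ} (h1 : 0 ≤ c1) (h2 : 0 ≤ c2)
    (h3 : 0 ≤ c3)
    (hX : ∀ i j, X i j = c1 * (v i * v j) + c2 * (w i * w j) - c3 * (if i = j then 1 else 0)) :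
    lam * (c1 * ‖v‖ ^ 2 + c2 * ‖w‖ ^ 2) - c3 * (d * Lam) ≤ pucciMinus lam Lam X := by
  have hquad : ∀ A ∈ ellipticSet lam Lam d, ∀ v : Ed d,
      lam * ‖v‖ ^ 2 ≤ ∑ i, ∑ j, A i j * (v j * v i) := by
    intro A hA v
    have h := hA.2.1.dotProduct_mulVec_nonneg (x := (v : Fin d → ℝ))
    have hn : ‖v‖ ^ 2 = ∑ i, v i * v i := by
      rw [EuclideanSpace.norm_sq_eq]
      refine Finset.sum_congr rfl fun i _ => ?_
      rw [Real.norm_eq_abs, sq_abs, sq]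
    rw [Matrix.sub_mulVec, dotProduct_sub, Matrix.smul_mulVec, Matrix.one_mulVec,
      dotProduct_smul] at h
    have e1 : star (v : Fin d → ℝ) ⬝ᵥ (v : Fin d → ℝ) = ‖v‖ ^ 2 := by
      rw [hn]; rfl
    have e2 : star (v : Fin d → ℝ) ⬝ᵥ (A.mulVec (v : Fin d → ℝ)) =
        ∑ i, ∑ j, A i j * (v j * v i) := by
      simp only [dotProduct, Matrix.mulVec, Finset.mul_sum]
      refine Finset.sum_congr rfl fun i _ => Finset.sum_congr rfl fun j _ => ?_
      simp
      ring
    rw [e1, e2, smul_eq_mul] at h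
    linarith
  have htr : ∀ A ∈ ellipticSet lam Lam d, A.trace ≤ d * Lam := by
    intro A hA
    have h := hA.2.2.trace_nonneg
    rw [Matrix.trace_sub, Matrix.trace_smul, Matrix.trace_one, Fintype.card_fin,
      smul_eq_mul] at h
    linarith
  apply le_csInf
  · refine Set.Nonempty.image _ ⟨lam • 1, ?_, ?_, ?_⟩
    · simp [Matrix.IsSymm]
    · rw [sub_self]; exact Matrix.PosSemidef.zero
    · rw [← sub_smul]
      exact Matrix.PosSemidef.one.smul (by linarith)
  · rintro _ ⟨A, hA, rfl⟩
    have e : (A * X).trace = c1 * (∑ i, ∑ j, A i j * (v j * v i)) +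
        c2 * (∑ i, ∑ j, A i j * (w j * w i)) - c3 * A.trace := by
      simp only [Matrix.trace, Matrix.diag, Matrix.mul_apply, hX, Finset.mul_sum]
      rw [← Finset.sum_add_distrib, ← Finset.sum_sub_distrib]
      refine Finset.sum_congr rfl fun i _ => ?_
      rw [← Finset.sum_add_distrib]
      have : c3 * A i i = ∑ j, A i j * (c3 * (if j = i then 1 else 0)) := by
        simp [mul_comm]
      rw [this, ← Finset.sum_sub_distrib]
      refine Finset.sum_congr rfl fun j _ => ?_
      ring
    simp only [e]
    have a1 := mul_le_mul_of_nonneg_left (hquad A hA v) h1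
    have a2 := mul_le_mul_of_nonneg_left (hquad A hA w) h2
    have a3 := mul_le_mul_of_nonneg_left (htr A hA) h3
    linarith


/-- Gaussian. -/
def gs {d : ℕ} (β : ℝ) (y x : Ed d) : ℝ := Real.exp (-(β * ‖x - y‖ ^ 2))

lemma gs_pos {d : ℕ} (β : ℝ) (y x : Ed d) : 0 < gs β y x := Real.exp_pos _

lemma gs_le_one {d : ℕ} {β : ℝ} (hβ : 0 ≤ β) (y x : Ed d) : gs β y x ≤ 1 := by
  unfold gs
  rw [Real.exp_le_one_iff]
  have : 0 ≤ β * ‖x - y‖ ^ 2 := by positivity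
  linarith

lemma gs_contDiff {d : ℕ} (β : ℝ) (y : Ed d) : ContDiff ℝ 2 (gs β y) := by
  unfold gs
  have : ContDiff ℝ 2 (fun x : Ed d => ‖x - y‖ ^ 2) :=
    ContDiff.norm_sq ℝ (contDiff_id.sub contDiff_const)
  exact ((contDiff_const.mul this).neg).exp

lemma gs_hasFDerivAt {d : ℕ} (β : ℝ) (y x : Ed d) :
    HasFDerivAt (gs β y) ((-(2 * β * gs β y x)) • innerSL ℝ (x - y)) x := by
  have h1 : HasFDerivAt (fun x : Ed d => ‖x - y‖ ^ 2) (2 • innerSL ℝ (x - y)) x := by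
    have := ((hasFDerivAt_id x).sub_const y).norm_sq
    simpa using this
  have h2 := (h1.const_mul β).neg.exp
  refine h2.congr_fderiv ?_
  ext z
  simp [gs]
  ring

lemma gs_diff {d : ℕ} {β : ℝ} (hβ : 0 ≤ β) (y x z : Ed d) :
    -(β * ‖z‖ ^ 2) ≤ gs β y (x + z) - gs β y x - ⟪(-(2 * β * gs β y x)) • (x - y), z⟫ := by
  have e : gs β y (x + z) = gs β y x * Real.exp (-(β * (2 * ⟪x - y, z⟫ + ‖z‖ ^ 2))) := by
    unfold gs
    rw [← Real.exp_add]
    congr 1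
    have : x + z - y = (x - y) + z := by abel
    rw [this, norm_add_sq_real]
    ring
  have h := Real.add_one_le_exp (-(β * (2 * ⟪x - y, z⟫ + ‖z‖ ^ 2)))
  have h' := mul_le_mul_of_nonneg_left h (gs_pos β y x).le
  rw [← e] at h'
  rw [real_inner_smul_left]
  have h1 := gs_le_one hβ y x
  have : gs β y x * (β * ‖z‖ ^ 2) ≤ 1 * (β * ‖z‖ ^ 2) :=
    mul_le_mul_of_nonneg_right h1 (by positivity)
  nlinarith

lemma gs_grad {d : ℕ} {α ρ : ℝ} (hα : 1 ≤ α) (hρ : 0 < ρ) (y x : Ed d) :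
    ‖(-(2 * (α / ρ ^ 2) * gs (α / ρ ^ 2) y x)) • (x - y)‖ ≤ 2 * α / ρ := by
  have hg := gs_pos (α / ρ ^ 2) y x
  rw [norm_smul, norm_neg, Real.norm_of_nonneg (by positivity)]
  set t := ‖x - y‖ / ρ with ht
  have ht0 : 0 ≤ t := by positivity
  have hx : ‖x - y‖ = t * ρ := by rw [ht]; field_simp
  have h1 : t * gs (α / ρ ^ 2) y x ≤ 1 := by
    have e : gs (α / ρ ^ 2) y x = Real.exp (-(α * t ^ 2)) := by
      unfold gs; congr 2; rw [hx]; field_simp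
    rw [e, Real.exp_neg, ← div_eq_mul_inv, div_le_one (Real.exp_pos _)]
    have := Real.add_one_le_exp (α * t ^ 2)
    nlinarith [sq_nonneg (t - 1), sq_nonneg t]
  rw [hx]
  have : 2 * (α / ρ ^ 2) * gs (α / ρ ^ 2) y x * (t * ρ) =
      2 * α / ρ * (t * gs (α / ρ ^ 2) y x) := by field_simp
  rw [this]
  have : 0 ≤ 2 * α / ρ := by positivity
  exact mul_le_of_le_one_right this h1

/-- bump function used for truncation -/
def bmp (d : ℕ) : ContDiffBump (0 : Ed d) where
  rIn := 2
  rOut := 3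
  rIn_pos := by norm_num
  rIn_lt_rOut := by norm_num

/-- truncated identity -/
def tV {d : ℕ} (x : Ed d) : Ed d := bmp d x • x

lemma tV_contDiff {d : ℕ} : ContDiff ℝ 2 (tV (d := d)) :=
  (bmp d).contDiff.smul contDiff_id

lemma tV_norm {d : ℕ} (x : Ed d) : ‖tV x‖ ≤ 3 := by
  unfold tV
  by_cases h : 3 ≤ ‖x‖
  · rw [(bmp d).zero_of_le_dist (by simpa [bmp] using h)]
    simp
  · push Not at h
    rw [norm_smul, Real.norm_of_nonneg (bmp d).nonneg]
    have := (bmp d).le_one (x := x)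
    have := (bmp d).nonneg (x := x)
    nlinarith [norm_nonneg x]

lemma tV_eq {d : ℕ} {x : Ed d} (h : ‖x‖ ≤ 2) : tV x = x := by
  unfold tV
  rw [(bmp d).one_of_mem_closedBall (by simpa [bmp] using h), one_smul]

lemma tV_diff {d : ℕ} {x p : Ed d} (hx : ‖x‖ ≤ 7 / 4) (hp : ‖p‖ ≤ 1) (z : Ed d) :
    -(84 * ‖z‖ ^ 2) ≤ ⟪p, tV (x + z)⟫ - ⟪p, tV x⟫ - ⟪p, z⟫ := by
  rw [tV_eq (x := x) (by linarith), ← inner_sub_right, ← inner_sub_right]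
  by_cases hz : ‖z‖ ≤ 1 / 4
  · have : ‖x + z‖ ≤ 2 := (norm_add_le _ _).trans (by linarith)
    rw [tV_eq this]
    simp
  · push Not at hz
    have h1 := abs_real_inner_le_norm p (tV (x + z) - x - z)
    have h2 : ‖tV (x + z) - x - z‖ ≤ 3 + 7 / 4 + ‖z‖ := by
      refine (norm_sub_le _ _).trans ?_
      gcongr
      refine (norm_sub_le _ _).trans ?_
      gcongr
      exact tV_norm _
    have h3 : ‖p‖ * ‖tV (x + z) - x - z‖ ≤ 1 * (3 + 7 / 4 + ‖z‖) := by gcongr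
    have h4 := (abs_le.1 h1).1
    nlinarith

/-- the test function -/
def tst {d : ℕ} (A1 A2 α β c : ℝ) (p y0 : Ed d) (x : Ed d) : ℝ :=
  A1 * gs α 0 x + ⟪p, tV x⟫ + A2 * gs β y0 x + c

/-- its local form -/
def tst0 {d : ℕ} (A1 A2 α β c : ℝ) (p y0 : Ed d) (x : Ed d) : ℝ :=
  A1 * gs α 0 x + ⟪p, x⟫ + A2 * gs β y0 x + c

lemma tst_contDiff {d : ℕ} (A1 A2 α β c : ℝ) (p y0 : Ed d) :
    ContDiff ℝ 2 (tst A1 A2 α β c p y0) := by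
  unfold tst
  exact (((contDiff_const.mul (gs_contDiff α 0)).add (contDiff_const.inner ℝ tV_contDiff)).add
    (contDiff_const.mul (gs_contDiff β y0))).add contDiff_const

lemma tst_bdd {d : ℕ} {A1 A2 α β c : ℝ} (hA1 : 0 ≤ A1) (hA2 : 0 ≤ A2) (hα : 0 ≤ α) (hβ : 0 ≤ β)
    (p y0 : Ed d) : IsBddFun (tst A1 A2 α β c p y0) := by
  refine ⟨A1 + ‖p‖ * 3 + A2 + |c|, fun x => ?_⟩
  unfold tst
  have h1 : |A1 * gs α 0 x| ≤ A1 := by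
    rw [abs_of_nonneg (mul_nonneg hA1 (gs_pos _ _ _).le)]
    exact mul_le_of_le_one_right hA1 (gs_le_one hα _ _)
  have h2 : |A2 * gs β y0 x| ≤ A2 := by
    rw [abs_of_nonneg (mul_nonneg hA2 (gs_pos _ _ _).le)]
    exact mul_le_of_le_one_right hA2 (gs_le_one hβ _ _)
  have h3 : |⟪p, tV x⟫| ≤ ‖p‖ * 3 :=
    (abs_real_inner_le_norm _ _).trans (mul_le_mul_of_nonneg_left (tV_norm x) (norm_nonneg _))
  refine (abs_add_le _ _).trans ?_
  gcongr
  refine (abs_add_le _ _).trans ?_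
  gcongr
  refine (abs_add_le _ _).trans ?_
  gcongr

lemma tst_eventuallyEq {d : ℕ} (A1 A2 α β c : ℝ) (p y0 : Ed d) {x : Ed d} (hx : ‖x‖ ≤ 7 / 4) :
    tst A1 A2 α β c p y0 =ᶠ[nhds x] tst0 A1 A2 α β c p y0 := by
  have : Metric.ball x (1 / 4) ∈ nhds x := Metric.ball_mem_nhds _ (by norm_num)
  filter_upwards [this] with z hz
  rw [mem_ball, dist_eq_norm] at hz
  unfold tst tst0
  rw [tV_eq]
  calc ‖z‖ = ‖(z - x) + x‖ := by simp
    _ ≤ ‖z - x‖ + ‖x‖ := norm_add_le _ _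
    _ ≤ 2 := by linarith

lemma tst0_hasFDerivAt {d : ℕ} (A1 A2 α β c : ℝ) (p y0 x : Ed d) :
    HasFDerivAt (tst0 A1 A2 α β c p y0)
      ((-(2 * α * A1 * gs α 0 x)) • innerSL ℝ x + innerSL ℝ p +
        (-(2 * β * A2 * gs β y0 x)) • innerSL ℝ (x - y0)) x := by
  have h1 := (gs_hasFDerivAt α 0 x).const_mul A1
  have h2 := (gs_hasFDerivAt β y0 x).const_mul A2
  have h3 : HasFDerivAt (fun x : Ed d => ⟪p, x⟫) (innerSL ℝ p) x := (innerSL ℝ p).hasFDerivAt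
  have := ((h1.add h3).add h2).add_const c
  refine this.congr_fderiv ?_
  ext z
  simp
  ring

lemma tst_gradient {d : ℕ} (A1 A2 α β c : ℝ) (p y0 : Ed d) {x : Ed d} (hx : ‖x‖ ≤ 7 / 4) :
    gradient (tst A1 A2 α β c p y0) x = (A1 • ((-(2 * α * gs α 0 x)) • (x - 0)) + p) +
        A2 • ((-(2 * β * gs β y0 x)) • (x - y0)) := by
  rw [gradient, (tst_eventuallyEq A1 A2 α β c p y0 hx).fderiv_eq,
    (tst0_hasFDerivAt A1 A2 α β c p y0 x).fderiv]
  apply (InnerProductSpace.toDual ℝ (Ed d)).injective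
  rw [LinearIsometryEquiv.apply_symm_apply]
  ext z
  simp
  ring

lemma tst_hess {d : ℕ} (A1 A2 α β c : ℝ) (p y0 : Ed d) {x : Ed d} (hx : ‖x‖ ≤ 7 / 4) (i j : Fin d) :
    hess (tst A1 A2 α β c p y0) x i j =
      (4 * α ^ 2 * A1 * gs α 0 x) * (x i * x j) +
      (4 * β ^ 2 * A2 * gs β y0 x) * ((x - y0) i * (x - y0) j) -
      (2 * α * A1 * gs α 0 x + 2 * β * A2 * gs β y0 x) * (if i = j then 1 else 0) := by
  have e := ((tst_eventuallyEq A1 A2 α β c p y0 hx).iteratedFDeriv ℝ 2).eq_of_nhds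
  simp only [hess, Matrix.of_apply]
  rw [e, iteratedFDeriv_two_apply]
  have hf : fderiv ℝ (tst0 A1 A2 α β c p y0) = fun x =>
      ((-(2 * α * A1 * gs α 0 x)) • innerSL ℝ x + innerSL ℝ p +
        (-(2 * β * A2 * gs β y0 x)) • innerSL ℝ (x - y0)) := by
    funext x
    exact (tst0_hasFDerivAt A1 A2 α β c p y0 x).fderiv
  have g1 : HasFDerivAt (fun x : Ed d => -(2 * α * A1 * gs α 0 x)) _ x :=
    ((gs_hasFDerivAt α 0 x).const_mul (2 * α * A1)).neg
  have g2 : HasFDerivAt (fun x : Ed d => -(2 * β * A2 * gs β y0 x)) _ x :=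
    ((gs_hasFDerivAt β y0 x).const_mul (2 * β * A2)).neg
  have l1 : HasFDerivAt (fun x : Ed d => innerSL ℝ x) (innerSL ℝ : Ed d →L[ℝ] _) x :=
    (innerSL ℝ : Ed d →L[ℝ] _).hasFDerivAt
  have l2 : HasFDerivAt (fun x : Ed d => innerSL ℝ (x - y0)) (innerSL ℝ : Ed d →L[ℝ] _) x := by
    have := l1.sub_const (innerSL ℝ y0)
    simpa using this
  have hh := ((g1.smul l1).add_const (innerSL ℝ p)).add (g2.smul l2)
  have hh' := hh.fderiv
  rw [hf]
  erw [hh']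
  have hs : (innerSL ℝ (EuclideanSpace.single i (1 : ℝ) : Ed d)) (EuclideanSpace.single j (1 : ℝ)) =
      if i = j then 1 else 0 := by
    rw [innerSL_apply_apply, EuclideanSpace.inner_single_left]
    simp [eq_comm]
  simp [EuclideanSpace.inner_single_right]
  erw [hs]
  by_cases hij : i = j
  · simp [hij]
    ring
  · simp [hij]
    ring

lemma touch_eq {d : ℕ} {lam Lam C0 : ℝ} (hLam : lam ≤ Lam) (hC0 : 0 ≤ C0)
    {K : Ed d → ℝ} (hK : KernCond K) {r ρ : ℝ} (hr : 0 < r) (hr1 : r ≤ 1)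
    (hρ : 0 < ρ) (hρ1 : ρ ≤ 1) {f u : Ed d → ℝ} {O : Set (Ed d)}
    (hu : SupersolExtremal lam Lam C0 r K f O u)
    {A1 A2 α c : ℝ} (hA1 : 0 ≤ A1) (hA2 : 0 ≤ A2) (hα : 1 ≤ α) {p y0 : Ed d} (hp : ‖p‖ ≤ 1)
    {x : Ed d} (hx : ‖x‖ ≤ 7 / 4) (hxO : x ∈ O)
    (hle : ∀ y, tst A1 A2 α (α / ρ ^ 2) c p y0 y ≤ u y)
    (heq : u x = tst A1 A2 α (α / ρ ^ 2) c p y0 x) :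
    f x ≤ -(lam * ((4 * α ^ 2 * A1 * gs α 0 x) * ‖x‖ ^ 2 +
        (4 * (α / ρ ^ 2) ^ 2 * A2 * gs (α / ρ ^ 2) y0 x) * ‖x - y0‖ ^ 2) -
        (2 * α * A1 * gs α 0 x + 2 * (α / ρ ^ 2) * A2 * gs (α / ρ ^ 2) y0 x) * (d * Lam)) +
      (2 * α * A1 + 84) * (sig K r + C0 * r) +
      (2 * α * A2 / ρ ^ 2) * (sig K (r * ρ) + C0 * (r * ρ)) := by
  set β := α / ρ ^ 2 with hβ
  have hα0 : 0 < α := by linarith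
  have hβ0 : 0 < β := by positivity
  set φ := tst A1 A2 α β c p y0 with hφ
  have h0 := hu φ (tst_contDiff _ _ _ _ _ _ _) (tst_bdd hA1 hA2 hα0.le hβ0.le p y0) x hxO hle heq
  have hg := tst_gradient A1 A2 α β c p y0 hx
  have hP := pucci_bound (lam := lam) (Lam := Lam) hLam (X := hess φ x)
    (v := x) (w := x - y0) (c1 := 4 * α ^ 2 * A1 * gs α 0 x) (c2 := 4 * β ^ 2 * A2 * gs β y0 x)
    (c3 := 2 * α * A1 * gs α 0 x + 2 * β * A2 * gs β y0 x)
    (by have := gs_pos α 0 x; positivity) (by have := gs_pos β y0 x; positivity)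
    (by have := gs_pos α 0 x; have := gs_pos β y0 x; positivity)
    (fun i j => tst_hess A1 A2 α β c p y0 hx i j)
  set w1 := (-(2 * α * gs α 0 x)) • (x - 0) with hw1
  set w2 := (-(2 * β * gs β y0 x)) • (x - y0) with hw2
  have hn1 : ‖w1‖ ≤ 2 * α := by
    have := gs_grad (ρ := 1) hα one_pos 0 x
    simpa [hw1] using this
  have hn2 : ‖w2‖ ≤ 2 * α / ρ := gs_grad hα hρ y0 x
  have hn1' : ‖A1 • w1 + p‖ ≤ 2 * α * A1 + 84 := by
    refine (norm_add_le _ _).trans ?_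
    rw [norm_smul, Real.norm_of_nonneg hA1]
    nlinarith [mul_le_mul_of_nonneg_left hn1 hA1]
  have hn2' : ‖A2 • w2‖ ≤ 2 * α * A2 / ρ := by
    rw [norm_smul, Real.norm_of_nonneg hA2]
    calc _ ≤ A2 * (2 * α / ρ) := mul_le_mul_of_nonneg_left hn2 hA2
      _ = _ := by ring
  have hnl : -nlMinus K r φ x ≤ (2 * α * A1 + 84) * sig K r +
      (2 * α * A2) / ρ ^ 2 * sig K (r * ρ) := by
    apply nlMinus_bound hK hr hr1 hρ hρ1 (by positivity) (by positivity)
    intro z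
    have b1 := incr_bound (r := r) (ρ := 1) (M := 2 * α * A1 + 84) hr one_pos (by positivity)
      (D := A1 * gs α 0 (x + z) + ⟪p, tV (x + z)⟫ - (A1 * gs α 0 x + ⟪p, tV x⟫))
      (v := A1 • w1 + p) (z := z) ?_ (by simpa using hn1') ?_
    have b2 := incr_bound (r := r) (ρ := ρ) (M := 2 * α * A2) hr hρ (by positivity)
      (D := A2 * gs β y0 (x + z) - A2 * gs β y0 x)
      (v := A2 • w2) (z := z) ?_ hn2' ?_
    · rw [mul_one] at b1
      refine le_trans (le_of_eq ?_) (add_le_add b1 b2)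
      have : (Metric.ball (0 : Ed d) (1 / r)).indicator (fun w => ⟪gradient φ x, w⟫) z =
          (Metric.ball (0 : Ed d) (1 / r)).indicator (fun w => ⟪A1 • w1 + p, w⟫) z +
          (Metric.ball (0 : Ed d) (1 / r)).indicator (fun w => ⟪A2 • w2, w⟫) z := by
        rw [hg]
        by_cases hz : z ∈ Metric.ball (0 : Ed d) (1 / r)
        · simp only [indicator_of_mem hz, inner_add_left]
        · simp only [indicator_of_notMem hz, add_zero]
      unfold deltaOp
      rw [this, hφ]
      unfold tst
      ring
    · have := gs_le_one hβ0.le y0 x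
      have := gs_pos β y0 (x + z)
      nlinarith [mul_nonneg hA2 this.le]
    · have := gs_diff hβ0.le y0 x z
      have := mul_le_mul_of_nonneg_left this hA2
      rw [real_inner_smul_left]
      have e : 2 * α * A2 / ρ ^ 2 * ‖z‖ ^ 2 = 2 * (A2 * (β * ‖z‖ ^ 2)) := by
        rw [hβ]; ring
      have : 0 ≤ A2 * (β * ‖z‖ ^ 2) := by positivity
      rw [e]
      linarith
    · have h1 := gs_le_one hα0.le 0 x
      have h2 := gs_pos α 0 (x + z)
      have i1 := abs_le.1 (abs_real_inner_le_norm p (tV (x + z)))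
      have i2 := abs_le.1 (abs_real_inner_le_norm p (tV x))
      have i3 : ‖p‖ * ‖tV (x + z)‖ ≤ 1 * 3 := by gcongr; exact tV_norm _
      have i4 : ‖p‖ * ‖tV x‖ ≤ 1 * 3 := by gcongr; exact tV_norm _
      nlinarith [mul_nonneg hA1 h2.le, mul_le_mul_of_nonneg_left h1 hA1]
    · have := gs_diff hα0.le 0 x z
      have := mul_le_mul_of_nonneg_left this hA1
      have := tV_diff hx hp z
      rw [inner_add_left, real_inner_smul_left]
      have : 0 ≤ A1 * (α * ‖z‖ ^ 2) := by positivity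
      simp only [one_pow, div_one]
      linarith
  have hgr : ‖gradient φ x‖ ≤ (2 * α * A1 + 84) + 2 * α * A2 / ρ := by
    rw [hg]
    exact (norm_add_le _ _).trans (add_le_add hn1' hn2')
  have hgr' := mul_le_mul_of_nonneg_left hgr (mul_nonneg hC0 hr.le)
  have e : C0 * r * (2 * α * A2 / ρ) = (2 * α * A2 / ρ ^ 2) * (C0 * (r * ρ)) := by field_simp
  rw [mul_add, e] at hgr'
  linarith


lemma touch_real {lam D α A1 ρ Q X Y g1 g2 E16 E4 δ s1 s2 F : ℝ} (hlam : 0 < lam) (hα : 1 ≤ α)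
    (hα2 : 2 * D + 1 ≤ α * lam / 4) (hA1 : 0 ≤ A1) (hD : 0 ≤ D) (hρ : 0 < ρ) (hQ : 0 < Q)
    (hX : 0 ≤ X) (hY : ρ ≤ Y) (hg1p : 0 < g1) (hg11 : g1 ≤ 1) (hg1E : E4 ≤ g1) (hE16p : 0 < E16)
    (hg2E : E16 ≤ g2) (hδ : s1 ≤ δ) (hδ' : s2 ≤ δ) (hδ1 : 4 * δ ≤ E16)
    (hδ2 : (2 * α * A1 + 84) * δ ≤ A1 * α * E4)
    (key : F ≤ -(lam * ((4 * α ^ 2 * A1 * g1) * X ^ 2 +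
        (4 * (α / ρ ^ 2) ^ 2 * (Q * ρ) * g2) * Y ^ 2) -
        (2 * α * A1 * g1 + 2 * (α / ρ ^ 2) * (Q * ρ) * g2) * D) +
      (2 * α * A1 + 84) * s1 +
      (2 * α * (Q * ρ) / ρ ^ 2) * s2) :
    (α * E16 / 2) * Q ≤ ρ * (|F| + if X < 1 / 4 then 2 * α * A1 * D + A1 * α * E4 else 0) := by
  have hα0 : 0 < α := by linarith
  set S := α * Q / ρ with hS
  have hSp : 0 ≤ S := by positivity
  set V := α * (Y / ρ) ^ 2 with hV
  have hVα : α ≤ V := by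
    have h1 : 1 ≤ Y / ρ := by rwa [le_div_iff₀ hρ, one_mul]
    have h2 : 1 ≤ (Y / ρ) ^ 2 := one_le_pow₀ h1
    rw [hV]
    exact le_mul_of_one_le_right hα0.le h2
  have key2 : F ≤ - (4 * α * lam * X ^ 2 - 2 * D) * (A1 * α * g1) -
      S * g2 * (4 * lam * V - 2 * D) + (2 * α * A1 + 84) * s1 + 2 * S * s2 := by
    refine key.trans (le_of_eq ?_)
    rw [hS, hV]
    field_simp
    ring
  have h1 : 1 ≤ 4 * lam * V - 2 * D := by
    have := mul_le_mul_of_nonneg_left hVα hlam.le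
    have : 0 < α * lam := by positivity
    linarith
  have h2 : S * E16 ≤ S * g2 := mul_le_mul_of_nonneg_left hg2E hSp
  have h3 : 0 ≤ S * g2 := h2.trans' (by positivity)
  have h4 : S * g2 * 1 ≤ S * g2 * (4 * lam * V - 2 * D) := mul_le_mul_of_nonneg_left h1 h3
  have k1 : 2 * S * s2 ≤ S * E16 / 2 := by
    have a1 := mul_le_mul_of_nonneg_left hδ' (by positivity : 0 ≤ 2 * S)
    have a2 := mul_le_mul_of_nonneg_left hδ1 (by positivity : 0 ≤ S / 2)
    linarith
  have k2 : (2 * α * A1 + 84) * s1 ≤ A1 * α * E4 :=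
    (mul_le_mul_of_nonneg_left hδ (by positivity)).trans hδ2
  have k3 := neg_abs_le F
  have hA : 0 ≤ A1 * α * g1 := by positivity
  have k4 : S * E16 / 2 ≤ |F| + if X < 1 / 4 then
        2 * α * A1 * D + A1 * α * E4 else 0 := by
    split_ifs with h
    · have h1 : 0 ≤ A1 * α * g1 * (4 * α * lam * X ^ 2) := by positivity
      have h2 : A1 * α * g1 * (2 * D) ≤ A1 * α * 1 * (2 * D) := by
        gcongr
      linarith
    · push Not at h
      have h1 : (1:ℝ) / 16 ≤ X ^ 2 := by nlinarith
      have h2 : 1 ≤ 4 * α * lam * X ^ 2 - 2 * D := by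
        have := mul_le_mul_of_nonneg_left h1 (by positivity : 0 ≤ 4 * α * lam)
        linarith
      have h3 : A1 * α * E4 ≤ A1 * α * g1 := by gcongr
      have h4 := mul_le_mul_of_nonneg_left h2 hA
      linarith
  calc α * E16 / 2 * Q = ρ * (S * E16 / 2) := by rw [hS]; field_simp
    _ ≤ _ := mul_le_mul_of_nonneg_left k4 hρ.le

set_option maxHeartbeats 1000000 in
lemma touch {d : ℕ} {lam Lam C0 : ℝ} (hlam : 0 < lam) (hLam : lam ≤ Lam) (hC0 : 0 ≤ C0)
    {K : Ed d → ℝ} (hK : KernCond K) {r ρ : ℝ} (hr : 0 < r) (hr1 : r ≤ 1)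
    (hρ : 0 < ρ) (hρ1 : ρ ≤ 1 / 28) {f u : Ed d → ℝ} (hlsc : LowerSemicontinuous u)
    (hu : SupersolExtremal lam Lam C0 r K f (Metric.ball 0 2) u)
    {A1 α δ : ℝ} (hA1 : 0 ≤ A1) (hα : 1 ≤ α) (hα2 : 2 * (d * Lam) + 1 ≤ α * lam / 4)
    (hδ : sig K r + C0 * r ≤ δ) (hδ1 : 4 * δ ≤ Real.exp (-(16 * α)))
    (hδ2 : (2 * α * A1 + 84) * δ ≤ A1 * α * Real.exp (-(4 * α)))
    {p0 p1 x0 x1 : Ed d} {c0 c1 : ℝ} (hp0 : ‖p0‖ ≤ 1) (hx0 : ‖x0‖ ≤ 3 / 2)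
    (hx1 : ‖x1‖ ≤ 2) (hx01 : ‖x1 - x0‖ ≤ ρ)
    (hle0 : ∀ y, A1 * gs α 0 y + ⟪p0, tV y⟫ + c0 ≤ u y)
    (heq0 : u x0 = A1 * gs α 0 x0 + ⟪p0, tV x0⟫ + c0)
    (hle1 : ∀ y, A1 * gs α 0 y + ⟪p1, tV y⟫ + c1 ≤ u y)
    (heq1 : u x1 = A1 * gs α 0 x1 + ⟪p1, tV x1⟫ + c1) :
    ∃ xs : Ed d, ‖xs - x0‖ ≤ 7 * ρ ∧ (α * Real.exp (-(16 * α)) / 2) * ‖p1 - p0‖ ≤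
      ρ * (|f xs| + if ‖xs‖ < 1 / 4 then
        2 * α * A1 * (d * Lam) + A1 * α * Real.exp (-(4 * α)) else 0) := by
  have hα0 : 0 < α := by linarith
  have hL0 : 0 < Lam := by linarith
  by_cases hq : p1 - p0 = 0
  · refine ⟨x0, by simp; positivity, ?_⟩
    rw [hq, norm_zero, mul_zero]
    split_ifs <;> positivity
  set q := p1 - p0 with hqdef
  have hqn : 0 < ‖q‖ := norm_pos_iff.2 hq
  set A2 := ‖q‖ * ρ with hA2
  have hA2p : 0 < A2 := by positivity
  set β := α / ρ ^ 2 with hβ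
  have hβ0 : 0 < β := by positivity
  -- the point y0
  set y0 : Ed d := x0 + (3 * ρ / ‖q‖) • q with hy0
  have hx0y0 : ‖x0 - y0‖ = 3 * ρ := by
    rw [hy0, sub_add_cancel_left, norm_neg, norm_smul, Real.norm_of_nonneg (by positivity)]
    field_simp
  have hgs : ∀ x, gs β y0 x = Real.exp (-(α * (‖x - y0‖ / ρ) ^ 2)) := by
    intro x
    unfold gs
    congr 2
    rw [hβ]
    field_simp
  have hgfar : ∀ x, 4 * ρ ≤ ‖x - y0‖ → gs β y0 x ≤ Real.exp (-(16 * α)) := by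
    intro x hx
    rw [hgs, Real.exp_le_exp]
    have : 4 ≤ ‖x - y0‖ / ρ := by rwa [le_div_iff₀ hρ]
    nlinarith [mul_le_mul this this (by norm_num) (by linarith)]
  have hgnear : ∀ x, ‖x - y0‖ ≤ 4 * ρ → Real.exp (-(16 * α)) ≤ gs β y0 x := by
    intro x hx
    rw [hgs, Real.exp_le_exp]
    have : ‖x - y0‖ / ρ ≤ 4 := by rwa [div_le_iff₀ hρ]
    have h0 : 0 ≤ ‖x - y0‖ / ρ := by positivity
    nlinarith [mul_le_mul this this h0 (by norm_num)]
  have hg0 : Real.exp (-(16 * α)) < gs β y0 x0 := by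
    rw [hgs, Real.exp_lt_exp, hx0y0]
    have : 3 * ρ / ρ = 3 := by field_simp
    rw [this]
    linarith
  set w : Ed d → ℝ := fun x => u x + -(A1 * gs α 0 x + ⟪p0, tV x⟫ + c0) with hw
  have hw0 : ∀ x, 0 ≤ w x := fun x => by simp only [hw]; linarith [hle0 x]
  set m : Ed d → ℝ := fun x => u x + (-(A1 * gs α 0 x + ⟪p0, tV x⟫ + c0) -
    A2 * (gs β y0 x - Real.exp (-(16 * α)))) with hm
  have hmw : ∀ x, m x = w x - A2 * (gs β y0 x - Real.exp (-(16 * α))) := fun x => by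
    simp only [hm, hw]; ring
  have hmlsc : LowerSemicontinuous m := by
    apply hlsc.add
    apply Continuous.lowerSemicontinuous
    have h1 := (gs_contDiff α (0 : Ed d)).continuous
    have h2 := (gs_contDiff β y0).continuous
    have h3 := (tV_contDiff (d := d)).continuous
    fun_prop
  have hmx0 : m x0 < 0 := by
    rw [hmw]
    have : w x0 = 0 := by simp only [hw]; linarith [heq0]
    rw [this]
    have := mul_pos hA2p (sub_pos.2 hg0)
    linarith
  have hx0mem : x0 ∈ closedBall y0 (4 * ρ) := by
    rw [mem_closedBall, dist_eq_norm, hx0y0]; linarith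
  obtain ⟨xs, hxs, hmin⟩ := (hmlsc.lowerSemicontinuousOn (closedBall y0 (4 * ρ))).exists_isMinOn
    ⟨x0, hx0mem⟩ (isCompact_closedBall _ _)
  have hmxs : m xs < 0 := lt_of_le_of_lt (hmin hx0mem) hmx0
  have hglob : ∀ x, m xs ≤ m x := by
    intro x
    by_cases hx : x ∈ closedBall y0 (4 * ρ)
    · exact hmin hx
    · rw [mem_closedBall, dist_eq_norm] at hx
      push Not at hx
      have h1 := hgfar x hx.le
      have h2 := hw0 x
      have : 0 ≤ m x := by
        rw [hmw]
        have := mul_nonneg hA2p.le (sub_nonneg.2 h1)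
        linarith
      linarith
  rw [mem_closedBall, dist_eq_norm] at hxs
  have hxsx0 : ‖xs - x0‖ ≤ 7 * ρ := by
    calc ‖xs - x0‖ = ‖(xs - y0) - (x0 - y0)‖ := by congr 1; abel
      _ ≤ ‖xs - y0‖ + ‖x0 - y0‖ := norm_sub_le _ _
      _ ≤ 7 * ρ := by linarith
  have hxsn : ‖xs‖ ≤ 7 / 4 := by
    calc ‖xs‖ = ‖(xs - x0) + x0‖ := by simp
      _ ≤ ‖xs - x0‖ + ‖x0‖ := norm_add_le _ _
      _ ≤ 7 / 4 := by linarith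
  -- lower bound on the distance
  have hinner : ⟪q, xs - x0⟫ < 2 * (ρ * ‖q‖) := by
    by_contra hcon
    push Not at hcon
    have h1 := hle1 xs
    rw [tV_eq (by linarith)] at h1
    have h2 := hle0 x1
    have h3 : A1 * gs α 0 x1 + ⟪p0, x1⟫ + c0 ≤ A1 * gs α 0 x1 + ⟪p1, x1⟫ + c1 := by
      rw [tV_eq hx1] at h2 heq1
      linarith
    have h4 : ⟪q, x1 - x0⟫ ≤ ‖q‖ * ρ :=
      (real_inner_le_norm _ _).trans (mul_le_mul_of_nonneg_left hx01 (norm_nonneg _))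
    have h5 : ‖q‖ * ρ ≤ w xs := by
      simp only [hw]
      rw [tV_eq (x := xs) (by linarith)]
      rw [inner_sub_right] at hcon h4
      rw [hqdef, inner_sub_left, inner_sub_left] at hcon h4
      linarith
    have h6 := gs_le_one hβ0.le y0 xs
    have h7 := Real.exp_pos (-(16 * α))
    rw [hmw] at hmxs
    have : A2 * (gs β y0 xs - Real.exp (-(16 * α))) ≤ A2 * 1 := by gcongr; linarith
    linarith
  have hdist : ρ ≤ ‖xs - y0‖ := by
    have h1 : ⟪q, y0 - xs⟫ ≤ ‖q‖ * ‖y0 - xs‖ := real_inner_le_norm _ _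
    have h2 : ⟪q, y0 - xs⟫ = 3 * ρ * ‖q‖ - ⟪q, xs - x0⟫ := by
      have : y0 - xs = (3 * ρ / ‖q‖) • q - (xs - x0) := by rw [hy0]; abel
      rw [this, inner_sub_right, real_inner_smul_right, real_inner_self_eq_norm_sq]
      field_simp
    rw [h2, norm_sub_rev y0 xs] at h1
    have : ‖q‖ * ρ ≤ ‖q‖ * ‖xs - y0‖ := by linarith
    exact le_of_mul_le_mul_left this hqn
  refine ⟨xs, hxsx0, ?_⟩
  have key := touch_eq (lam := lam) (Lam := Lam) hLam hC0 hK hr hr1 hρ (by linarith) hu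
    (A1 := A1) (A2 := A2) (α := α) (c := c0 - A2 * Real.exp (-(16 * α)) + m xs) hA1 hA2p.le hα
    (p := p0) (y0 := y0) hp0 (x := xs) hxsn
    (by rw [mem_ball, dist_zero_right]; linarith)
    (by
      intro y
      have := hglob y
      rw [hmw y] at this
      simp only [hw] at this
      unfold tst
      rw [← hβ]
      linarith)
    (by
      have := hmw xs
      simp only [hw] at this
      unfold tst
      rw [← hβ]
      linarith)
  have hsig : sig K (r * ρ) + C0 * (r * ρ) ≤ δ := by
    have h1 : r * ρ ≤ r := mul_le_of_le_one_right hr.le (by linarith)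
    have := sig_mono hK (s := r * ρ) (s' := r) (by positivity) h1 hr1
    have := mul_le_mul_of_nonneg_left h1 hC0
    linarith
  refine touch_real hlam hα hα2 hA1 (by positivity) hρ hqn (norm_nonneg xs) hdist
    (gs_pos _ _ _) (gs_le_one hα0.le _ _) ?_ (Real.exp_pos _) (hgnear xs hxs) hδ hsig hδ1 hδ2 key
  unfold gs
  rw [Real.exp_le_exp, sub_zero]
  have : ‖xs‖ ^ 2 ≤ 4 := by nlinarith [norm_nonneg xs]
  nlinarith

/-- Lipschitz images, with respect to Lebesgue measure. -/
lemma volume_lipschitz_image {d : ℕ} {T : Ed d → Ed d} {s : Set (Ed d)} {L : NNReal}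
    (h : LipschitzOnWith L T s) : volume (T '' s) ≤ (L : ℝ≥0∞) ^ d * volume s := by
  have hfr : ((Module.finrank ℝ (Ed d) : ℕ) : ℝ) = d := by simp
  have hH := isAddHaarMeasure_hausdorffMeasure (E := Ed d)
  have e := Measure.isAddLeftInvariant_eq_smul (volume : Measure (Ed d))
    (Measure.hausdorffMeasure (Module.finrank ℝ (Ed d) : ℝ))
  have hl := h.hausdorffMeasure_image_le (d := (Module.finrank ℝ (Ed d) : ℝ)) (by positivity)
  rw [e, Measure.smul_apply, Measure.smul_apply]
  rw [show ((L : ℝ≥0∞) ^ (Module.finrank ℝ (Ed d) : ℝ)) = (L : ℝ≥0∞) ^ d by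
    rw [hfr, ENNReal.rpow_natCast]] at hl
  rw [ENNReal.smul_def, ENNReal.smul_def, smul_eq_mul, smul_eq_mul, mul_left_comm]
  exact mul_le_mul_right hl _

/-- Area-type estimate. -/
lemma area {d : ℕ} {T : Ed d → Ed d} {S W : Set (Ed d)} (hSW : S ⊆ W) (hW : MeasurableSet W)
    {κ : Ed d → ℝ} {ρ : ℝ} (hρ : 0 < ρ) (hκ : ∀ z, 0 ≤ κ z)
    (h : ∀ x ∈ S, ∀ y ∈ S, ‖y - x‖ < ρ → ∀ z ∈ W, ‖z - x‖ < ρ →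
      ‖T y - T x‖ ≤ κ z * ‖y - x‖) :
    volume (T '' S) ≤ ∫⁻ z in W, (ENNReal.ofReal (κ z)) ^ d := by
  obtain ⟨c, hc⟩ := TopologicalSpace.exists_dense_seq (Ed d)
  set Q : ℕ → Set (Ed d) := disjointed (fun n => ball (c n) (ρ / 2)) with hQ
  have hQm : ∀ n, MeasurableSet (Q n) := fun n =>
    MeasurableSet.disjointed (fun n => measurableSet_ball) n
  have hQd : Pairwise (Function.onFun Disjoint Q) := disjoint_disjointed _
  have hQu : ⋃ n, Q n = univ := by
    rw [hQ, iUnion_disjointed]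
    rw [eq_univ_iff_forall]
    intro x
    obtain ⟨n, hn⟩ := hc.exists_dist_lt x (half_pos hρ)
    exact mem_iUnion.2 ⟨n, hn⟩
  have hQs : ∀ n, ∀ x ∈ Q n, ∀ y ∈ Q n, ‖y - x‖ < ρ := by
    intro n x hx y hy
    have h1 := disjointed_subset _ n hx
    have h2 := disjointed_subset _ n hy
    rw [← dist_eq_norm]
    calc dist y x ≤ dist y (c n) + dist x (c n) := dist_triangle_right _ _ _
      _ < ρ / 2 + ρ / 2 := add_lt_add h2 h1
      _ = ρ := by ring
  have hpiece : ∀ n, volume (T '' (S ∩ Q n)) ≤ ∫⁻ z in W ∩ Q n, (ENNReal.ofReal (κ z)) ^ d := by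
    intro n
    have hb : ∀ z ∈ W ∩ Q n, volume (T '' (S ∩ Q n)) ≤
        (ENNReal.ofReal (κ z)) ^ d * volume (W ∩ Q n) := by
      intro z hz
      have hl : LipschitzOnWith (κ z).toNNReal T (S ∩ Q n) := by
        apply LipschitzOnWith.of_dist_le_mul
        intro y hy x hx
        rw [dist_eq_norm, dist_eq_norm, Real.coe_toNNReal _ (hκ z)]
        exact h x hx.1 y hy.1 (hQs n x hx.2 y hy.2) z hz.1 (hQs n x hx.2 z hz.2)
      refine (volume_lipschitz_image hl).trans ?_
      exact mul_le_mul_right (measure_mono (inter_subset_inter_left _ hSW)) _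
    by_cases h0 : volume (W ∩ Q n) = 0
    · have : volume (T '' (S ∩ Q n)) = 0 := by
        rcases (W ∩ Q n).eq_empty_or_nonempty with he | ⟨z, hz⟩
        · have : S ∩ Q n = ∅ := by
            rw [← subset_empty_iff, ← he]
            exact inter_subset_inter_left _ hSW
          simp [this]
        · have := hb z hz
          rw [h0, mul_zero] at this
          exact le_antisymm this bot_le
      rw [this]; exact bot_le
    · have hfin : volume (W ∩ Q n) ≠ ⊤ := by
        refine ne_of_lt (lt_of_le_of_lt (measure_mono (inter_subset_right.trans
          (disjointed_subset _ n))) measure_ball_lt_top)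
      calc volume (T '' (S ∩ Q n)) =
          (volume (T '' (S ∩ Q n)) / volume (W ∩ Q n)) * volume (W ∩ Q n) :=
            (ENNReal.div_mul_cancel h0 hfin).symm
        _ = ∫⁻ _ in W ∩ Q n, (volume (T '' (S ∩ Q n)) / volume (W ∩ Q n)) := by
            rw [setLIntegral_const]
        _ ≤ _ := by
            apply setLIntegral_mono' (hW.inter (hQm n))
            intro z hz
            exact ENNReal.div_le_of_le_mul (hb z hz)
  have e1 : T '' S = ⋃ n, T '' (S ∩ Q n) := by
    rw [← image_iUnion, ← inter_iUnion, hQu, inter_univ]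
  have e2 : W = ⋃ n, W ∩ Q n := by rw [← inter_iUnion, hQu, inter_univ]
  rw [e1, e2, lintegral_iUnion (fun n => hW.inter (hQm n))]
  · refine (measure_iUnion_le _).trans ?_
    refine ENNReal.tsum_le_tsum fun n => ?_
    exact hpiece n
  · intro i j hij
    exact (hQd hij).mono inter_subset_right inter_subset_right


lemma contact_exists {d : ℕ} {u : Ed d → ℝ} (hlsc : LowerSemicontinuous u) (hu0 : ∀ x, 0 ≤ u x)
    {α A1 : ℝ} (hα : 1 ≤ α) (hA1 : 0 ≤ A1)
    (hA : A1 * (Real.exp (-α) - Real.exp (-(9 / 4 * α))) = 3)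
    (hx : ∃ x, ‖x‖ ≤ 1 ∧ u x ≤ 1) {p : Ed d} (hp : ‖p‖ ≤ 1 / 8) :
    ∃ x : Ed d, ∃ c : ℝ, ‖x‖ ≤ 3 / 2 ∧ u x ≤ A1 + 1 ∧
      (∀ y, A1 * gs α 0 y + ⟪p, tV y⟫ + c ≤ u y) ∧
      u x = A1 * gs α 0 x + ⟪p, tV x⟫ + c := by
  obtain ⟨xb, hxb, hub⟩ := hx
  have hin : ∀ y : Ed d, |⟪p, tV y⟫| ≤ 3 / 8 := fun y =>
    (abs_real_inner_le_norm _ _).trans (by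
      have := mul_le_mul hp (tV_norm y) (norm_nonneg _) (by norm_num)
      linarith)
  set m : Ed d → ℝ := fun y => u y + -(A1 * gs α 0 y + ⟪p, tV y⟫) with hm
  have hmlsc : LowerSemicontinuous m := by
    apply hlsc.add
    apply Continuous.lowerSemicontinuous
    have h1 := (gs_contDiff α (0 : Ed d)).continuous
    have h3 := (tV_contDiff (d := d)).continuous
    fun_prop
  have hmem : xb ∈ closedBall (0 : Ed d) (3 / 2) := by
    rw [mem_closedBall, dist_zero_right]; linarith
  have hG2 := Real.exp_pos (-(9 / 4 * α))
  have hmb : m xb ≤ -(A1 * Real.exp (-(9 / 4 * α))) - 13 / 8 := by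
    have h1 : Real.exp (-α) ≤ gs α 0 xb := by
      unfold gs
      rw [Real.exp_le_exp, sub_zero]
      have : ‖xb‖ ^ 2 ≤ 1 := pow_le_one₀ (norm_nonneg _) hxb
      nlinarith
    have h2 := mul_le_mul_of_nonneg_left h1 hA1
    have h3 := neg_le_of_abs_le (hin xb)
    simp only [hm]
    linarith
  have hfar : ∀ y, 3 / 2 < ‖y‖ → -(A1 * Real.exp (-(9 / 4 * α))) - 3 / 8 ≤ m y := by
    intro y hy
    have h1 : gs α 0 y ≤ Real.exp (-(9 / 4 * α)) := by
      unfold gs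
      rw [Real.exp_le_exp, sub_zero]
      have : 9 / 4 ≤ ‖y‖ ^ 2 := by nlinarith
      nlinarith
    have h2 := mul_le_mul_of_nonneg_left h1 hA1
    have h3 := le_of_abs_le (hin y)
    have := hu0 y
    simp only [hm]
    linarith
  obtain ⟨xs, hxs, hmin⟩ := (hmlsc.lowerSemicontinuousOn (closedBall 0 (3 / 2))).exists_isMinOn
    ⟨xb, hmem⟩ (isCompact_closedBall _ _)
  have hb : m xs ≤ m xb := hmin hmem
  have hglob : ∀ y, m xs ≤ m y := by
    intro y
    by_cases hy : y ∈ closedBall (0 : Ed d) (3 / 2)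
    · exact hmin hy
    · rw [mem_closedBall, dist_zero_right, not_le] at hy
      have := hfar y hy
      linarith
  rw [mem_closedBall, dist_zero_right] at hxs
  refine ⟨xs, m xs, hxs, ?_, ?_, ?_⟩
  · have h1 := mul_le_mul_of_nonneg_left (gs_le_one (by linarith : 0 ≤ α) 0 xs) hA1
    have h2 := le_of_abs_le (hin xs)
    have h3 : m xs = u xs + -(A1 * gs α 0 xs + ⟪p, tV xs⟫) := rfl
    have h4 := mul_nonneg hA1 hG2.le
    linarith
  · intro y
    have h1 := hglob y
    have h3 : m y = u y + -(A1 * gs α 0 y + ⟪p, tV y⟫) := rfl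
    linarith
  · have h3 : m xs = u xs + -(A1 * gs α 0 xs + ⟪p, tV xs⟫) := rfl
    linarith

lemma pow_add3_le (a b c : ℝ≥0∞) (n : ℕ) :
    (a + b + c) ^ n ≤ 3 ^ n * (a ^ n + b ^ n + c ^ n) := by
  have h1 : a + b + c ≤ 3 * max (max a b) c := by
    have e : (3 : ℝ≥0∞) * max (max a b) c = max (max a b) c + max (max a b) c + max (max a b) c := by
      ring
    rw [e]
    gcongr
    · exact (le_max_left _ _).trans (le_max_left _ _)
    · exact (le_max_right _ _).trans (le_max_left _ _)
    · exact le_max_right _ _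
  calc (a + b + c) ^ n ≤ (3 * max (max a b) c) ^ n := by gcongr
    _ = 3 ^ n * (max (max a b) c) ^ n := mul_pow _ _ _
    _ ≤ _ := by
      gcongr
      rcases max_choice (max a b) c with h | h
      · rw [h]
        rcases max_choice a b with h | h
        · rw [h, add_assoc]; exact le_self_add
        · rw [h, add_right_comm]; exact le_add_self
      · rw [h]; exact le_add_self

set_option maxHeartbeats 1000000 in
lemma abp_area {d : ℕ} {lam Lam C0 : ℝ} (hlam : 0 < lam) (hLam : lam ≤ Lam)
    (hC0 : 0 ≤ C0) {K : Ed d → ℝ} (hK : KernCond K) {r : ℝ} (hr : 0 < r) (hr1 : r ≤ 1)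
    {f u : Ed d → ℝ} (hf : ContinuousOn f (ball 0 2)) (hlsc : LowerSemicontinuous u)
    (hu0 : ∀ x, 0 ≤ u x) (hu : SupersolExtremal lam Lam C0 r K f (Metric.ball 0 2) u)
    {A1 α δ : ℝ} (hA1 : 0 ≤ A1) (hα : 1 ≤ α) (hα2 : 2 * (d * Lam) + 1 ≤ α * lam / 4)
    (hδ : sig K r + C0 * r ≤ δ) (hδ1 : 4 * δ ≤ Real.exp (-(16 * α)))
    (hδ2 : (2 * α * A1 + 84) * δ ≤ A1 * α * Real.exp (-(4 * α)))
    (hA : A1 * (Real.exp (-α) - Real.exp (-(9 / 4 * α))) = 3)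
    (hx : ∃ x, ‖x‖ ≤ 1 ∧ u x ≤ 1) {ε : ℝ} (hε : 0 < ε)
    {C1 c : ℝ} (hC1 : C1 = 2 * α * A1 * (d * Lam) + A1 * α * Real.exp (-(4 * α)))
    (hc : c = α * Real.exp (-(16 * α)) / 2) :
    volume (closedBall (0 : Ed d) (1 / 8)) ≤ ENNReal.ofReal (3 / c) ^ d *
      ((∫⁻ z in ball (0 : Ed d) 2, ENNReal.ofReal |f z| ^ d) +
        ENNReal.ofReal ε ^ d * volume (ball (0 : Ed d) 2) +
        ENNReal.ofReal C1 ^ d * volume ({x | u x ≤ A1 + 1} ∩ ball 0 (1 / 2))) := by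
  have hα0 : 0 < α := by linarith
  have hL0 : 0 < Lam := by linarith
  have hcp : 0 < c := by rw [hc]; positivity
  have hC1p : 0 ≤ C1 := by rw [hC1]; positivity
  set D := closedBall (0 : Ed d) (1 / 8) with hD
  have hDp : ∀ p ∈ D, ‖p‖ ≤ 1 / 8 := fun p hp => by simpa [hD] using hp
  have hex : ∀ p : Ed d, ∃ x : Ed d, ∃ c : ℝ, p ∈ D → ‖x‖ ≤ 3 / 2 ∧ u x ≤ A1 + 1 ∧
      (∀ y, A1 * gs α 0 y + ⟪p, tV y⟫ + c ≤ u y) ∧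
      u x = A1 * gs α 0 x + ⟪p, tV x⟫ + c := by
    intro p
    by_cases hp : p ∈ D
    · obtain ⟨x, c, h⟩ := contact_exists hlsc hu0 hα hA1 hA hx (hDp p hp)
      exact ⟨x, c, fun _ => h⟩
    · exact ⟨0, 0, fun h => absurd h hp⟩
  choose X cc hX using hex
  have hsub : closedBall (0 : Ed d) (7 / 4) ⊆ ball 0 2 := closedBall_subset_ball (by norm_num)
  have hcomp := isCompact_closedBall (0 : Ed d) (7 / 4)
  have hfc := hf.mono hsub
  obtain ⟨F, hF⟩ := hcomp.exists_bound_of_continuousOn hfc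
  have huc := Metric.uniformContinuousOn_iff.1 (hcomp.uniformContinuousOn_of_continuous hfc) ε hε
  obtain ⟨η, hη, hfη⟩ := huc
  -- main touching statement
  have htouch : ∀ p0 ∈ D, ∀ p1 ∈ D, ∀ ρ, 0 < ρ → ρ ≤ 1 / 28 → ‖X p1 - X p0‖ ≤ ρ →
      ∃ xs : Ed d, ‖xs - X p0‖ ≤ 7 * ρ ∧ c * ‖p1 - p0‖ ≤
        ρ * (|f xs| + if ‖xs‖ < 1 / 4 then C1 else 0) := by
    intro p0 h0 p1 h1 ρ hρ hρ1 hd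
    obtain ⟨a1, a2, a3, a4⟩ := hX p0 h0
    obtain ⟨b1, b2, b3, b4⟩ := hX p1 h1
    rw [hC1, hc]
    exact touch hlam hLam hC0 hK hr hr1 hρ hρ1 hlsc hu hA1 hα hα2 hδ hδ1 hδ2
      ((hDp p0 h0).trans (by norm_num)) a1 (b1.trans (by norm_num)) hd a3 a4 b3 b4
  have hxsn : ∀ p0 ∈ D, ∀ xs ρ, ρ ≤ 1 / 28 → ‖xs - X p0‖ ≤ 7 * ρ → xs ∈ closedBall (0 : Ed d) (7 / 4) := by
    intro p0 h0 xs ρ h1 h2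
    rw [mem_closedBall, dist_zero_right]
    calc ‖xs‖ = ‖(xs - X p0) + X p0‖ := by simp
      _ ≤ ‖xs - X p0‖ + ‖X p0‖ := norm_add_le _ _
      _ ≤ 7 / 4 := by linarith [(hX p0 h0).1]
  have hF0 : 0 ≤ F := (norm_nonneg _).trans (hF 0 (mem_closedBall_self (by norm_num)))
  have hinj : InjOn X D := by
    intro p0 h0 p1 h1 he
    by_contra hne
    have hpos : 0 < ‖p1 - p0‖ := norm_pos_iff.2 (sub_ne_zero.2 (Ne.symm hne))
    have hle : ∀ ρ, 0 < ρ → ρ ≤ 1 / 28 → c * ‖p1 - p0‖ ≤ ρ * (F + C1) := by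
      intro ρ hρ hρ1
      obtain ⟨xs, hxs, h⟩ := htouch p0 h0 p1 h1 ρ hρ hρ1 (by rw [he, sub_self, norm_zero]; exact hρ.le)
      refine h.trans ?_
      gcongr
      · exact hF xs (hxsn p0 h0 xs ρ hρ1 hxs)
      · split_ifs
        · exact le_rfl
        · exact hC1p
    set t := c * ‖p1 - p0‖ with ht
    have htp : 0 < t := by positivity
    have h1 := hle (min (1 / 28) (t / (2 * (F + C1 + 1)))) (by positivity) (min_le_left _ _)
    have h2 : min (1 / 28) (t / (2 * (F + C1 + 1))) * (F + C1) ≤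
        t / (2 * (F + C1 + 1)) * (F + C1 + 1) :=
      mul_le_mul (min_le_right _ _) (by linarith) (by positivity) (by positivity)
    have h3 : t / (2 * (F + C1 + 1)) * (F + C1 + 1) = t / 2 := by field_simp
    linarith
  set T := Function.invFunOn X D with hT
  have hTX : ∀ p ∈ D, T (X p) = p := hinj.leftInvOn_invFunOn
  set S := X '' D with hS
  have hTS : T '' S = D := by
    rw [hS, image_image]
    exact (image_congr (fun p hp => hTX p hp)).trans (image_id' D)
  set W := {x | u x ≤ A1 + 1} ∩ closedBall (0 : Ed d) (3 / 2) with hW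
  have hWm : MeasurableSet W :=
    (hlsc.isClosed_preimage (A1 + 1)).measurableSet.inter measurableSet_closedBall
  have hSW : S ⊆ W := by
    rintro _ ⟨p, hp, rfl⟩
    obtain ⟨a1, a2, a3, a4⟩ := hX p hp
    exact ⟨a2, by rwa [mem_closedBall, dist_zero_right]⟩
  set κ : Ed d → ℝ := fun z => c⁻¹ * (|f z| + ε + (ball (0 : Ed d) (1 / 2)).indicator (fun _ => C1) z)
    with hκ
  have hind : ∀ z : Ed d, 0 ≤ (ball (0 : Ed d) (1 / 2)).indicator (fun _ => C1) z := fun z =>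
    indicator_nonneg (fun _ _ => hC1p) z
  have hκ0 : ∀ z, 0 ≤ κ z := fun z => by
    have := hind z
    simp only [hκ]
    positivity
  have harea := area (T := T) (S := S) (W := W) hSW hWm (κ := κ) (ρ := min (1 / 40) (η / 8))
    (by positivity) hκ0 (by
    rintro _ ⟨p0, h0, rfl⟩ _ ⟨p1, h1, rfl⟩ hd z hz hzd
    rw [hTX p0 h0, hTX p1 h1]
    by_cases hne : X p1 = X p0
    · rw [hinj h1 h0 hne]; simp
    have hpos : 0 < ‖X p1 - X p0‖ := norm_pos_iff.2 (sub_ne_zero.2 hne)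
    have hd1 := hd.trans_le (min_le_left _ _)
    have hd2 := hd.trans_le (min_le_right _ _)
    have hz1 := hzd.trans_le (min_le_left _ _)
    have hz2 := hzd.trans_le (min_le_right _ _)
    obtain ⟨xs, hxs, h⟩ := htouch p0 h0 p1 h1 _ hpos (by linarith) le_rfl
    have hxz : ‖xs - z‖ ≤ ‖xs - X p0‖ + ‖z - X p0‖ := by
      rw [norm_sub_rev z]; exact norm_sub_le_norm_sub_add_norm_sub _ _ _
    have hfx : |f xs| ≤ |f z| + ε := by
      have := hfη xs (hxsn p0 h0 xs _ (by linarith) hxs) z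
        (closedBall_subset_closedBall (by norm_num) hz.2) (by rw [dist_eq_norm]; linarith)
      rw [Real.dist_eq] at this
      have := abs_sub_abs_le_abs_sub (f xs) (f z)
      linarith
    have hi : (if ‖xs‖ < 1 / 4 then C1 else 0) ≤ (ball (0 : Ed d) (1 / 2)).indicator (fun _ => C1) z := by
      split_ifs with hlt
      · rw [indicator_of_mem]
        rw [mem_ball, dist_zero_right]
        calc ‖z‖ = ‖xs - (xs - z)‖ := by simp
          _ ≤ ‖xs‖ + ‖xs - z‖ := norm_sub_le _ _
          _ < 1 / 2 := by linarith
      · exact hind z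
    simp only [hκ]
    rw [mul_assoc, inv_mul_eq_div, le_div_iff₀ hcp, mul_comm, mul_comm _ ‖X p1 - X p0‖]
    refine h.trans ?_
    gcongr)
  rw [hTS] at harea
  refine harea.trans ?_
  have hsplit : ∀ z, ENNReal.ofReal (κ z) ^ d ≤ ENNReal.ofReal (3 / c) ^ d *
      (ENNReal.ofReal |f z| ^ d + ENNReal.ofReal ε ^ d +
        (ball (0 : Ed d) (1 / 2)).indicator (fun _ => ENNReal.ofReal C1 ^ d) z) := by
    intro z
    have h3 : ENNReal.ofReal (3 / c) = ENNReal.ofReal c⁻¹ * 3 := by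
      rw [div_eq_inv_mul, ENNReal.ofReal_mul (by positivity)]
      norm_num
    simp only [hκ]
    rw [ENNReal.ofReal_mul (by positivity), ENNReal.ofReal_add (by positivity) (hind z),
      ENNReal.ofReal_add (by positivity) hε.le, mul_pow, h3, mul_pow, mul_assoc]
    refine mul_le_mul_right ((pow_add3_le _ _ _ _).trans ?_) _
    gcongr
    by_cases hz : z ∈ ball (0 : Ed d) (1 / 2)
    · rw [indicator_of_mem hz, indicator_of_mem hz]
    · rw [indicator_of_notMem hz, indicator_of_notMem hz, ENNReal.ofReal_zero]
      rcases Nat.eq_zero_or_pos d with h0 | h0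
      · exfalso
        subst h0
        apply hz
        rw [Subsingleton.elim z 0]
        exact mem_ball_self (by norm_num)
      · rw [zero_pow h0.ne']
  calc ∫⁻ z in W, ENNReal.ofReal (κ z) ^ d ≤ ∫⁻ z in W, ENNReal.ofReal (3 / c) ^ d *
      (ENNReal.ofReal |f z| ^ d + ENNReal.ofReal ε ^ d +
        (ball (0 : Ed d) (1 / 2)).indicator (fun _ => ENNReal.ofReal C1 ^ d) z) :=
        lintegral_mono hsplit
    _ = ENNReal.ofReal (3 / c) ^ d * ∫⁻ z in W,
      (ENNReal.ofReal |f z| ^ d + ENNReal.ofReal ε ^ d +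
        (ball (0 : Ed d) (1 / 2)).indicator (fun _ => ENNReal.ofReal C1 ^ d) z) := by
        rw [lintegral_const_mul' _ _ (ENNReal.pow_ne_top ENNReal.ofReal_ne_top)]
    _ ≤ _ := by
        refine mul_le_mul_right ?_ _
        rw [lintegral_add_right _ (measurable_const.indicator measurableSet_ball),
          lintegral_add_right _ measurable_const, setLIntegral_const,
          lintegral_indicator_const measurableSet_ball, Measure.restrict_apply measurableSet_ball]
        have hW2 : W ⊆ ball 0 2 := fun z hz =>
          closedBall_subset_ball (by norm_num : (3:ℝ) / 2 < 2) hz.2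
        have h1 : ∫⁻ z in W, ENNReal.ofReal |f z| ^ d ≤ ∫⁻ z in ball 0 2, ENNReal.ofReal |f z| ^ d :=
          lintegral_mono_set hW2
        have h2 : ball 0 (1 / 2) ∩ W ⊆ {x | u x ≤ A1 + 1} ∩ ball 0 (1 / 2) := fun z hz =>
          ⟨hz.2.1, hz.1⟩
        gcongr

/-- The basic measure estimate at unit scale. -/
lemma key_meas {d : ℕ} (hd : 1 ≤ d) {lam Lam C0 : ℝ} (hlam : 0 < lam) (hLam : lam ≤ Lam)
    (hC0 : 0 ≤ C0) {K : Ed d → ℝ} (hK : KernCond K) :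
    ∃ r0 ε0 M μ : ℝ, 0 < r0 ∧ r0 ≤ 1 ∧ 0 < ε0 ∧ 1 < M ∧ 0 < μ ∧
      ∀ r, 0 < r → r ≤ r0 → ∀ f u : Ed d → ℝ, ContinuousOn f (ball 0 2) →
        LowerSemicontinuous u → (∀ x, 0 ≤ u x) →
        SupersolExtremal lam Lam C0 r K f (Metric.ball 0 2) u →
        (∫⁻ z in ball (0 : Ed d) 2, ENNReal.ofReal |f z| ^ d) ≤ ENNReal.ofReal ε0 →
        (∃ x, ‖x‖ ≤ 1 ∧ u x ≤ 1) →
        ENNReal.ofReal μ ≤ volume ({x | u x ≤ M} ∩ ball (0 : Ed d) 1) := by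
  have hL0 : 0 < Lam := by linarith
  have hdL : 0 ≤ d * Lam := by positivity
  set α : ℝ := 4 * (2 * (d * Lam) + 1) / lam + 1 with hα
  have hα1 : 1 ≤ α := by
    have : 0 ≤ 4 * (2 * (d * Lam) + 1) / lam := by positivity
    linarith
  have hα0 : 0 < α := by linarith
  have hα2 : 2 * (d * Lam) + 1 ≤ α * lam / 4 := by
    have : α * lam / 4 = 2 * (d * Lam) + 1 + lam / 4 := by rw [hα]; field_simp
    linarith
  have hG : 0 < Real.exp (-α) - Real.exp (-(9 / 4 * α)) := by
    rw [sub_pos, Real.exp_lt_exp]; linarith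
  set A1 : ℝ := 3 / (Real.exp (-α) - Real.exp (-(9 / 4 * α))) with hA1
  have hA1p : 0 < A1 := by positivity
  have hA : A1 * (Real.exp (-α) - Real.exp (-(9 / 4 * α))) = 3 := by
    rw [hA1, div_mul_cancel₀ _ hG.ne']
  set δ : ℝ := min (Real.exp (-(16 * α)) / 4) (A1 * α * Real.exp (-(4 * α)) / (2 * α * A1 + 84)) with hδ
  have hδp : 0 < δ := by
    have := Real.exp_pos (-(16 * α))
    have := Real.exp_pos (-(4 * α))
    positivity
  have hδ1 : 4 * δ ≤ Real.exp (-(16 * α)) := by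
    have : δ ≤ Real.exp (-(16 * α)) / 4 := min_le_left _ _
    linarith
  have hδ2 : (2 * α * A1 + 84) * δ ≤ A1 * α * Real.exp (-(4 * α)) := by
    have : δ ≤ A1 * α * Real.exp (-(4 * α)) / (2 * α * A1 + 84) := min_le_right _ _
    rw [le_div_iff₀ (by positivity)] at this
    linarith
  obtain ⟨r0, hr0, hr01, hr0δ, hsig⟩ := sig_small hK (δ := δ / (1 + C0)) (by positivity)
  obtain ⟨C1, hC1⟩ : ∃ C1, C1 = 2 * α * A1 * (d * Lam) + A1 * α * Real.exp (-(4 * α)) := ⟨_, rfl⟩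
  obtain ⟨c, hc⟩ : ∃ c, c = α * Real.exp (-(16 * α)) / 2 := ⟨_, rfl⟩
  have hcp : 0 < c := by rw [hc]; positivity
  have hC1p : 0 < C1 := by rw [hC1]; positivity
  set v := (volume (closedBall (0 : Ed d) (1 / 8))).toReal with hv
  have hvt : volume (closedBall (0 : Ed d) (1 / 8)) ≠ ⊤ := measure_closedBall_lt_top.ne
  have hvp : 0 < v := ENNReal.toReal_pos (measure_closedBall_pos _ _ (by norm_num)).ne' hvt
  set b := (volume (ball (0 : Ed d) 2)).toReal with hb
  have hbt : volume (ball (0 : Ed d) 2) ≠ ⊤ := measure_ball_lt_top.ne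
  have hbp : 0 < b := ENNReal.toReal_pos (measure_ball_pos _ _ (by norm_num)).ne' hbt
  set Q := (3 / c) ^ d with hQ
  have hQp : 0 < Q := by positivity
  set ε := min 1 (v / (4 * Q * b)) with hε
  have hεp : 0 < ε := by positivity
  refine ⟨r0, v / (4 * Q), A1 + 1, v / (4 * Q * C1 ^ d), hr0, hr01, by positivity, by linarith,
    by positivity, ?_⟩
  intro r hr hrr f u hf hlsc hu0 hu hfi hx
  have hr1 := hrr.trans hr01
  have hsigr : sig K r + C0 * r ≤ δ := by
    have h1 := sig_mono hK hr.le hrr hr01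
    have h2 := mul_le_mul_of_nonneg_left (hrr.trans hr0δ) hC0
    have h3 : δ / (1 + C0) + C0 * (δ / (1 + C0)) = δ := by field_simp
    linarith
  have hmain := abp_area hlam hLam hC0 hK hr hr1 hf hlsc hu0 hu hA1p.le hα1 hα2 hsigr hδ1 hδ2 hA hx
    hεp hC1 hc
  have hsub : {x | u x ≤ A1 + 1} ∩ ball (0 : Ed d) (1 / 2) ⊆ {x | u x ≤ A1 + 1} ∩ ball 0 1 :=
    inter_subset_inter_right _ (ball_subset_ball (by norm_num))
  refine le_trans ?_ (measure_mono hsub)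
  set Z := {x | u x ≤ A1 + 1} ∩ ball (0 : Ed d) (1 / 2) with hZ
  have hZt : volume Z ≠ ⊤ := ((measure_mono inter_subset_right).trans_lt measure_ball_lt_top).ne
  by_contra hcon
  push Not at hcon
  rw [← ENNReal.ofReal_toReal hZt] at hcon hmain
  set m := (volume Z).toReal with hm
  have hm0 : 0 ≤ m := ENNReal.toReal_nonneg
  rw [ENNReal.ofReal_lt_ofReal_iff (by positivity)] at hcon
  have h2 : volume (closedBall (0 : Ed d) (1 / 8)) ≤
      ENNReal.ofReal (Q * (v / (4 * Q) + ε ^ d * b + C1 ^ d * m)) := by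
    refine hmain.trans ?_
    rw [ENNReal.ofReal_mul (by positivity), ENNReal.ofReal_add (by positivity) (by positivity),
      ENNReal.ofReal_add (by positivity) (by positivity), ENNReal.ofReal_mul (by positivity),
      ENNReal.ofReal_mul (by positivity), hQ, ENNReal.ofReal_pow (by positivity),
      ENNReal.ofReal_pow (by positivity), ENNReal.ofReal_pow (by positivity), hb,
      ENNReal.ofReal_toReal hbt]
    gcongr
  rw [← ENNReal.ofReal_toReal hvt, ← hv, ENNReal.ofReal_le_ofReal_iff (by positivity)] at h2
  have h3 : ε ^ d ≤ v / (4 * Q * b) :=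
    (pow_le_of_le_one hεp.le (min_le_left _ _) (by omega)).trans (min_le_right _ _)
  have h4 : Q * (ε ^ d * b) ≤ v / 4 := by
    calc Q * (ε ^ d * b) ≤ Q * (v / (4 * Q * b) * b) := by gcongr
      _ = v / 4 := by field_simp
  have h5 : Q * (C1 ^ d * m) ≤ v / 4 := by
    calc Q * (C1 ^ d * m) ≤ Q * (C1 ^ d * (v / (4 * Q * C1 ^ d))) := by gcongr
      _ = v / 4 := by field_simp
  have h6 : Q * (v / (4 * Q)) = v / 4 := by field_simp
  rw [mul_add, mul_add, h6] at h2
  linarith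

lemma fderiv_rescale {d : ℕ} {F : Type*} [NormedAddCommGroup F] [NormedSpace ℝ F] {G : Ed d → F}
    (hG : Differentiable ℝ G) (a b : ℝ) (x0 x : Ed d) :
    fderiv ℝ (fun x => a • G (b • (x - x0))) x = (a * b) • fderiv ℝ G (b • (x - x0)) := by
  have h1 : HasFDerivAt (fun x : Ed d => b • (x - x0)) (b • ContinuousLinearMap.id ℝ (Ed d)) x :=
    ((hasFDerivAt_id x).sub_const x0).const_smul b
  have h2 := ((hG (b • (x - x0))).hasFDerivAt.comp x h1).const_smul a
  have h3 := h2.fderiv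
  refine h3.trans ?_
  ext v
  simp [mul_smul]

open scoped Pointwise in
lemma pucciMinus_smul {d : ℕ} (lam Lam : ℝ) {c : ℝ} (hc : 0 < c) (X : Matrix (Fin d) (Fin d) ℝ) :
    pucciMinus lam Lam (c • X) = c * pucciMinus lam Lam X := by
  unfold pucciMinus
  have e : (fun A => (A * (c • X)).trace) '' ellipticSet lam Lam d =
      c • ((fun A => (A * X).trace) '' ellipticSet lam Lam d) := by
    ext t
    simp only [mem_image, mem_smul_set, Matrix.mul_smul, Matrix.trace_smul]
    constructor
    · rintro ⟨A, hA, rfl⟩; exact ⟨_, ⟨A, hA, rfl⟩, rfl⟩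
    · rintro ⟨_, ⟨A, hA, rfl⟩, rfl⟩; exact ⟨A, hA, rfl⟩
  rw [e, Real.sInf_smul_of_nonneg hc.le, smul_eq_mul]

/-- Rescaling of supersolutions. -/
lemma supersol_scale {d : ℕ} {lam Lam C0 : ℝ} {K : Ed d → ℝ} {r ρ s : ℝ} (hr : 0 < r)
    (hρ : 0 < ρ) (hs : 0 < s) {f u : Ed d → ℝ} {O O' : Set (Ed d)} (x0 : Ed d)
    (hO : ∀ y ∈ O', x0 + ρ • y ∈ O)
    (hu : SupersolExtremal lam Lam C0 r K f O u) :
    SupersolExtremal lam Lam C0 (r * ρ) K (fun y => s * ρ ^ 2 * f (x0 + ρ • y)) O'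
      (fun y => s * u (x0 + ρ • y)) := by
  intro φ hφ hφb y hy hle heq
  set ψ : Ed d → ℝ := fun x => s⁻¹ • φ (ρ⁻¹ • (x - x0)) with hψ
  have hback : ∀ x : Ed d, x0 + ρ • (ρ⁻¹ • (x - x0)) = x := fun x => by
    rw [smul_smul, mul_inv_cancel₀ hρ.ne', one_smul]; abel
  have hforw : ∀ z : Ed d, ρ⁻¹ • (x0 + ρ • z - x0) = z := fun z => by
    rw [add_sub_cancel_left, smul_smul, inv_mul_cancel₀ hρ.ne', one_smul]
  have hψy : ∀ z, ψ (x0 + ρ • z) = s⁻¹ * φ z := fun z => by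
    simp only [hψ, hforw, smul_eq_mul]
  have hψc : ContDiff ℝ 2 ψ :=
    (hφ.comp ((contDiff_id.sub contDiff_const).const_smul ρ⁻¹)).const_smul s⁻¹
  have hψb : IsBddFun ψ := by
    obtain ⟨M, hM⟩ := hφb
    refine ⟨s⁻¹ * M, fun x => ?_⟩
    simp only [hψ, smul_eq_mul]
    rw [abs_mul, abs_of_pos (inv_pos.2 hs)]
    gcongr
    exact hM _
  have h := hu ψ hψc hψb (x0 + ρ • y) (hO y hy) (by
    intro x
    have := hle (ρ⁻¹ • (x - x0))
    simp only [hback] at this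
    simp only [hψ, smul_eq_mul]
    rw [inv_mul_le_iff₀ hs]
    exact this) (by
    rw [hψy, ← heq, inv_mul_cancel_left₀ hs.ne'])
  have hφd : Differentiable ℝ φ := hφ.differentiable (by norm_num)
  have hφd2 : Differentiable ℝ (fderiv ℝ φ) :=
    (hφ.fderiv_right (m := 1) (by norm_num)).differentiable (by norm_num)
  have hfd : fderiv ℝ ψ = fun x => (s⁻¹ * ρ⁻¹) • fderiv ℝ φ (ρ⁻¹ • (x - x0)) := by
    funext x
    exact fderiv_rescale hφd _ _ _ _
  have hgrad : gradient ψ (x0 + ρ • y) = (s⁻¹ * ρ⁻¹) • gradient φ y := by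
    unfold gradient
    rw [hfd]
    simp only [hforw, map_smul]
  have hhess : hess ψ (x0 + ρ • y) = (s⁻¹ * ρ⁻¹ * ρ⁻¹) • hess φ y := by
    ext i j
    simp only [hess, Matrix.of_apply, Matrix.smul_apply, iteratedFDeriv_two_apply]
    rw [hfd, fderiv_rescale hφd2, hforw]
    simp
  have hdelta : ∀ w, deltaOp ψ r (x0 + ρ • y) (ρ • w) = s⁻¹ * deltaOp φ (r * ρ) y w := by
    intro w
    unfold deltaOp
    rw [hgrad, add_assoc, ← smul_add, hψy, hψy]
    have hm : ρ • w ∈ ball (0 : Ed d) (1 / r) ↔ w ∈ ball (0 : Ed d) (1 / (r * ρ)) := by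
      rw [mem_ball, mem_ball, dist_zero_right, dist_zero_right, norm_smul,
        Real.norm_of_nonneg hρ.le, lt_div_iff₀ hr, lt_div_iff₀ (by positivity)]
      rw [show ρ * ‖w‖ * r = ‖w‖ * (r * ρ) by ring]
    by_cases hw : w ∈ ball (0 : Ed d) (1 / (r * ρ))
    · rw [indicator_of_mem hw, indicator_of_mem (hm.2 hw), real_inner_smul_left,
        real_inner_smul_right]
      field_simp
    · rw [indicator_of_notMem hw, indicator_of_notMem (fun h => hw (hm.1 h))]
      ring
  have hnl : nlMinus K r ψ (x0 + ρ • y) = s⁻¹ * ρ⁻¹ * ρ⁻¹ * nlMinus K (r * ρ) φ y := by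
    unfold nlMinus
    have hcv := Measure.integral_comp_smul (volume : Measure (Ed d))
      (fun z => max (-deltaOp ψ r (x0 + ρ • y) z) 0 * Kresc K r z) ρ
    have e : (fun w : Ed d => max (-deltaOp ψ r (x0 + ρ • y) (ρ • w)) 0 * Kresc K r (ρ • w)) =
        fun w => (s⁻¹ * (ρ ^ (d + 2))⁻¹) * (max (-deltaOp φ (r * ρ) y w) 0 * Kresc K (r * ρ) w) := by
      funext w
      rw [hdelta]
      have h1 : max (-(s⁻¹ * deltaOp φ (r * ρ) y w)) 0 = s⁻¹ * max (-deltaOp φ (r * ρ) y w) 0 := by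
        rw [mul_max_of_nonneg _ _ (inv_pos.2 hs).le]
        simp
      rw [h1]
      simp only [Kresc, smul_smul, mul_pow]
      field_simp
    rw [e, integral_const_mul] at hcv
    have hfr : Module.finrank ℝ (Ed d) = d := by simp
    rw [hfr, abs_of_pos (by positivity), smul_eq_mul] at hcv
    have h2 : ∫ z, max (-deltaOp ψ r (x0 + ρ • y) z) 0 * Kresc K r z =
        ρ ^ d * (s⁻¹ * (ρ ^ (d + 2))⁻¹ * ∫ w, max (-deltaOp φ (r * ρ) y w) 0 * Kresc K (r * ρ) w) := by
      rw [hcv, ← mul_assoc, mul_inv_cancel₀ (by positivity), one_mul]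
    rw [h2, pow_add]
    field_simp
  rw [hhess, pucciMinus_smul _ _ (by positivity), hnl, hgrad, norm_smul,
    Real.norm_of_nonneg (by positivity)] at h
  have h4 := mul_le_mul_of_nonneg_left h (by positivity : 0 ≤ s * ρ ^ 2)
  refine h4.trans (le_of_eq ?_)
  field_simp

open scoped Pointwise in
/-- Scaling of volumes. -/
lemma volume_scale {d : ℕ} {ρ : ℝ} (hρ : 0 < ρ) (x0 : Ed d) (S : Set (Ed d)) :
    volume S = ENNReal.ofReal ρ ^ d * volume {y | x0 + ρ • y ∈ S} := by
  have e : S = (fun z => x0 + z) '' (ρ • {y | x0 + ρ • y ∈ S}) := by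
    ext x
    simp only [mem_image, mem_smul_set, mem_ofPred_eq]
    constructor
    · intro hx
      refine ⟨x - x0, ⟨ρ⁻¹ • (x - x0), ?_, ?_⟩, by abel⟩
      · rw [smul_smul, mul_inv_cancel₀ hρ.ne', one_smul]; simpa
      · rw [smul_smul, mul_inv_cancel₀ hρ.ne', one_smul]
    · rintro ⟨_, ⟨y, hy, rfl⟩, rfl⟩
      exact hy
  conv_lhs => rw [e]
  rw [image_add_left, measure_preimage_add, Measure.addHaar_smul]
  rw [abs_of_nonneg (by positivity), finrank_euclideanSpace_fin, ENNReal.ofReal_pow hρ.le]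

/-- Scaling of lower integrals. -/
lemma lintegral_scale {d : ℕ} {ρ : ℝ} (hρ : 0 < ρ) (x0 : Ed d) (g : Ed d → ℝ≥0∞) :
    ∫⁻ x, g x = ENNReal.ofReal ρ ^ d * ∫⁻ y, g (x0 + ρ • y) := by
  have hm : MeasurableEmbedding (fun y : Ed d => x0 + ρ • y) :=
    ((Homeomorph.smulOfNeZero ρ hρ.ne').trans (Homeomorph.addLeft x0)).measurableEmbedding
  have e : (volume : Measure (Ed d)) = ENNReal.ofReal ρ ^ d • Measure.map (fun y : Ed d => x0 + ρ • y) volume := by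
    ext S hS
    rw [Measure.smul_apply, hm.map_apply, smul_eq_mul]
    exact volume_scale hρ x0 S
  conv_lhs => rw [e]
  rw [lintegral_smul_measure, hm.lintegral_map, smul_eq_mul]

lemma setLIntegral_scale {d : ℕ} {ρ : ℝ} (hρ : 0 < ρ) (x0 : Ed d) (R : ℝ) (g : Ed d → ℝ≥0∞) :
    ∫⁻ x in ball x0 (R * ρ), g x = ENNReal.ofReal ρ ^ d * ∫⁻ y in ball (0 : Ed d) R, g (x0 + ρ • y) := by
  rw [← lintegral_indicator measurableSet_ball, ← lintegral_indicator measurableSet_ball,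
    lintegral_scale hρ x0]
  congr 2
  funext y
  have : x0 + ρ • y ∈ ball x0 (R * ρ) ↔ y ∈ ball (0 : Ed d) R := by
    rw [mem_ball, mem_ball, dist_zero_right, dist_eq_norm, add_sub_cancel_left, norm_smul,
      Real.norm_of_nonneg hρ.le, mul_comm, mul_lt_mul_iff_left₀ hρ]
  by_cases h : y ∈ ball (0 : Ed d) R
  · rw [indicator_of_mem h, indicator_of_mem (this.2 h)]
  · rw [indicator_of_notMem h, indicator_of_notMem (fun h' => h (this.1 h'))]

lemma lsc_scale {d : ℕ} {u : Ed d → ℝ} (hu : LowerSemicontinuous u) {s : ℝ} (hs : 0 < s) (ρ : ℝ)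
    (x0 : Ed d) : LowerSemicontinuous (fun y => s * u (x0 + ρ • y)) := by
  intro x t ht
  have h1 : t / s < u (x0 + ρ • x) := by rwa [div_lt_iff₀' hs]
  have h2 : ContinuousAt (fun y : Ed d => x0 + ρ • y) x := by fun_prop
  filter_upwards [h2.eventually (hu _ _ h1)] with y hy
  exact (div_lt_iff₀' hs).1 hy

lemma measureReal_ball_pos {d : ℕ} (y : Ed d) (t : ℝ) (ht : 0 < t) : 0 < volume.real (ball y t) :=
  ENNReal.toReal_pos (measure_ball_pos _ _ ht).ne' measure_ball_lt_top.ne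

lemma real_ball {d : ℕ} (y : Ed d) {t : ℝ} (ht : 0 < t) :
    volume.real (ball y t) = t ^ d * volume.real (ball (0 : Ed d) 1) := by
  rw [measureReal_def, measureReal_def, Measure.addHaar_ball_of_pos _ _ ht, ENNReal.toReal_mul,
    finrank_euclideanSpace_fin, ENNReal.toReal_ofReal (by positivity)]

lemma real_closedBall {d : ℕ} (y : Ed d) {t : ℝ} (ht : 0 < t) :
    volume.real (closedBall y t) = t ^ d * volume.real (ball (0 : Ed d) 1) := by
  rw [measureReal_def, measureReal_def, Measure.addHaar_closedBall _ _ ht.le, ENNReal.toReal_mul,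
    finrank_euclideanSpace_fin, ENNReal.toReal_ofReal (by positivity)]

lemma exists_q (d : ℕ) {μ : ℝ} (hμ : 0 < μ) (_hμ1 : μ < 1) :
    ∃ q : ℝ, 0 < q ∧ q < 1 ∧ (1 - μ) ≤ (1 - μ / 2) * q ^ d := by
  have hc : ContinuousAt (fun q : ℝ => (1 - μ / 2) * q ^ d) 1 := by fun_prop
  have h1 : (1 - μ) < (fun q : ℝ => (1 - μ / 2) * q ^ d) 1 := by simp; linarith
  have h2 : ∀ᶠ q in nhds (1:ℝ), (1 - μ) < (1 - μ / 2) * q ^ d :=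
    hc.eventually (lt_mem_nhds h1)
  have h3 : ∀ᶠ q in nhds (1:ℝ), 0 < q := lt_mem_nhds one_pos
  have h4 := ((h2.and h3).filter_mono (nhdsWithin_le_nhds (s := Iio 1))).and self_mem_nhdsWithin
  obtain ⟨q, ⟨hq, hq0⟩, hq1⟩ := h4.exists
  exact ⟨q, hq0, hq1, hq.le⟩

lemma ink_ball {d : ℕ} {E F : Set (Ed d)} (hE : IsOpen E) (hEB : E ⊆ ball 0 1) {μ q : ℝ}
    (hμ : 0 < μ) (hq0 : 0 < q) (hq1 : q < 1) (hq : (1 - μ) ≤ (1 - μ / 2) * q ^ d)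
    (h1 : volume.real E ≤ (1 - μ) * volume.real (ball (0 : Ed d) 1))
    (hden : ∀ (y : Ed d) (t : ℝ), 0 < t → ‖y‖ + t ≤ 1 →
      (1 - μ) * volume.real (ball y t) < volume.real (E ∩ ball y t) → ball y t ⊆ F)
    {x : Ed d} (hx : x ∈ E) :
    ∃ (y : Ed d) (t : ℝ), 0 < t ∧ t ≤ 1 ∧ x ∈ ball y t ∧ ball y t ⊆ F ∧
      volume.real (E ∩ ball y t) ≤ (1 - μ / 2) * volume.real (ball y t) := by
  have hx1 : ‖x‖ < 1 := by simpa using hEB hx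
  set V := volume.real (ball (0 : Ed d) 1) with hV
  have hVp : 0 < V := measureReal_ball_pos _ _ one_pos
  set B : ℕ → Set (Ed d) := fun k => ball ((1 - q ^ k) • x) (q ^ k) with hB
  have hqk : ∀ k, 0 < q ^ k ∧ q ^ k ≤ 1 := fun k => ⟨by positivity, pow_le_one₀ hq0.le hq1.le⟩
  have hmono : ∀ k, B (k + 1) ⊆ B k := by
    intro k
    apply ball_subset_ball'
    rw [dist_eq_norm, ← sub_smul, norm_smul]
    have h2 : q ^ (k + 1) ≤ q ^ k := pow_le_pow_of_le_one hq0.le hq1.le (Nat.le_succ k)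
    rw [Real.norm_of_nonneg (by linarith)]
    nlinarith [norm_nonneg x]
  have hsmall : ∃ k, B k ⊆ E := by
    obtain ⟨e, he, hbe⟩ := Metric.isOpen_iff.1 hE x hx
    obtain ⟨k, hk⟩ := exists_pow_lt_of_lt_one (half_pos he) hq1
    refine ⟨k, (ball_subset_ball' ?_).trans hbe⟩
    have : (1 - q ^ k) • x - x = (- q ^ k) • x := by module
    rw [dist_eq_norm, this, norm_smul, norm_neg, Real.norm_of_nonneg (hqk k).1.le]
    nlinarith [(hqk k).1, norm_nonneg x]
  by_cases hμ1 : μ < 1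
  swap
  · exfalso
    have h2 : volume.real E ≤ 0 := h1.trans (by nlinarith)
    obtain ⟨k, hk⟩ := hsmall
    have hfin : volume E ≠ ⊤ := ((measure_mono hEB).trans_lt measure_ball_lt_top).ne
    have h3 := measureReal_mono hk hfin
    have h4 : 0 < volume.real (B k) := measureReal_ball_pos _ _ (hqk k).1
    linarith
  have hex : ∃ k, (1 - μ) * volume.real (B k) < volume.real (E ∩ B k) := by
    obtain ⟨k, hk⟩ := hsmall
    refine ⟨k, ?_⟩
    rw [inter_eq_right.2 hk]
    have h4 : 0 < volume.real (B k) := measureReal_ball_pos _ _ (hqk k).1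
    nlinarith
  classical
  set n := Nat.find hex with hn
  have hns := Nat.find_spec hex
  have hn0 : n ≠ 0 := by
    intro h0
    rw [← hn, h0] at hns
    simp only [hB, pow_zero, sub_self, zero_smul] at hns
    rw [inter_eq_left.2 hEB] at hns
    linarith
  obtain ⟨k, hk⟩ := Nat.exists_eq_succ_of_ne_zero hn0
  have hkk : volume.real (E ∩ B k) ≤ (1 - μ) * volume.real (B k) := by
    have := Nat.find_min hex (m := k) (by rw [← hn, hk]; exact Nat.lt_succ_self k)
    linarith
  rw [← hn, hk] at hns
  refine ⟨(1 - q ^ (k + 1)) • x, q ^ (k + 1), (hqk _).1, (hqk _).2, ?_, hden _ _ (hqk _).1 ?_ hns, ?_⟩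
  · rw [mem_ball, dist_eq_norm]
    have : x - (1 - q ^ (k + 1)) • x = q ^ (k + 1) • x := by module
    rw [this, norm_smul, Real.norm_of_nonneg (hqk _).1.le]
    nlinarith [(hqk (k + 1)).1]
  · rw [norm_smul, Real.norm_of_nonneg (by linarith [(hqk (k + 1)).2])]
    nlinarith [(hqk (k + 1)).2, norm_nonneg x]
  · have hfin : volume (E ∩ B k) ≠ ⊤ :=
      ((measure_mono inter_subset_right).trans_lt measure_ball_lt_top).ne
    have h2 : volume.real (E ∩ B (k + 1)) ≤ volume.real (E ∩ B k) :=
      measureReal_mono (inter_subset_inter_right _ (hmono k)) hfin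
    have h3 : volume.real (B k) = (q ^ k) ^ d * V := real_ball _ (hqk _).1
    have h4 : volume.real (ball ((1 - q ^ (k + 1)) • x) (q ^ (k + 1))) = (q ^ (k + 1)) ^ d * V :=
      real_ball _ (hqk _).1
    refine h2.trans (hkk.trans ?_)
    rw [h3, h4, pow_succ, mul_pow]
    have := mul_le_mul_of_nonneg_right hq (by positivity : 0 ≤ (q ^ k) ^ d * V)
    linarith

/-- Ink spots. -/
lemma ink_spots {d : ℕ} {E F : Set (Ed d)} (hE : IsOpen E) (hEF : E ⊆ F) (hFB : F ⊆ ball 0 1) {μ : ℝ}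
    (hμ : 0 < μ) (hμ1 : μ < 1)
    (h1 : volume.real E ≤ (1 - μ) * volume.real (ball (0 : Ed d) 1))
    (hden : ∀ (y : Ed d) (t : ℝ), 0 < t → ‖y‖ + t ≤ 1 →
      (1 - μ) * volume.real (ball y t) < volume.real (E ∩ ball y t) → ball y t ⊆ F) :
    volume.real E ≤ (5 ^ d * (2 / μ)) * (volume.real F - volume.real E) := by
  obtain ⟨q, hq0, hq1, hq⟩ := exists_q d hμ hμ1
  have hEB := hEF.trans hFB
  have hex : ∀ x : Ed d, ∃ (y : Ed d) (t : ℝ), x ∈ E → 0 < t ∧ t ≤ 1 ∧ x ∈ ball y t ∧ ball y t ⊆ F ∧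
      volume.real (E ∩ ball y t) ≤ (1 - μ / 2) * volume.real (ball y t) := by
    intro x
    by_cases hx : x ∈ E
    · obtain ⟨y, t, h⟩ := ink_ball hE hEB hμ hq0 hq1 hq h1 hden hx
      exact ⟨y, t, fun _ => h⟩
    · exact ⟨0, 0, fun h => absurd h hx⟩
  choose Y R hYR using hex
  obtain ⟨I, hIE, hdis, hcov⟩ := Vitali.exists_disjoint_subfamily_covering_enlargement_closedBall
    E Y R 1 (fun a ha => (hYR a ha).2.1) 5 (by norm_num)
  have hIc : I.Countable := by
    apply hdis.countable_of_nonempty_interior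
    intro a ha
    exact ⟨Y a, ball_subset_interior_closedBall (mem_ball_self (hYR a (hIE ha)).1)⟩
  have hFfin : volume F ≠ ⊤ := ((measure_mono hFB).trans_lt measure_ball_lt_top).ne
  have hEfin : volume E ≠ ⊤ := ((measure_mono hEB).trans_lt measure_ball_lt_top).ne
  have hEsub : E ⊆ ⋃ a ∈ I, closedBall (Y a) (5 * R a) := by
    intro x hx
    obtain ⟨b, hb, hsub⟩ := hcov x hx
    exact mem_biUnion hb (hsub (ball_subset_closedBall (hYR x hx).2.2.1))
  have hball : ∀ a ∈ I, volume (closedBall (Y a) (5 * R a)) ≤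
      ENNReal.ofReal (5 ^ d * (2 / μ)) * volume (ball (Y a) (R a) \ E) := by
    intro a ha
    obtain ⟨t0, t1, _, hF, hm⟩ := hYR a (hIE ha)
    have hbf : volume (ball (Y a) (R a)) ≠ ⊤ := measure_ball_lt_top.ne
    have hdf : volume (ball (Y a) (R a) \ E) ≠ ⊤ :=
      ((measure_mono diff_subset).trans_lt measure_ball_lt_top).ne
    rw [← ENNReal.ofReal_toReal hdf, ← ENNReal.ofReal_mul (by positivity),
      ← ENNReal.ofReal_toReal (measure_closedBall_lt_top (x := Y a) (r := 5 * R a)).ne]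
    apply ENNReal.ofReal_le_ofReal
    change volume.real _ ≤ _ * volume.real _
    have h2 := measureReal_diff_add_inter (μ := volume) (s := ball (Y a) (R a)) hE.measurableSet hbf
    rw [inter_comm] at h2
    rw [real_closedBall _ (by positivity)]
    rw [real_ball _ t0] at h2 hm
    set b := volume.real (ball (0 : Ed d) 1)
    have h3 : μ / 2 * (R a ^ d * b) ≤ volume.real (ball (Y a) (R a) \ E) := by linarith
    calc (5 * R a) ^ d * b = (5 ^ d * (2 / μ)) * (μ / 2 * (R a ^ d * b)) := by
          rw [mul_pow]; field_simp
      _ ≤ _ := by gcongr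
  have hsum : volume E ≤ ENNReal.ofReal (5 ^ d * (2 / μ)) * volume (F \ E) := by
    haveI := hIc.to_subtype
    calc volume E ≤ volume (⋃ a ∈ I, closedBall (Y a) (5 * R a)) := measure_mono hEsub
      _ ≤ ∑' a : I, volume (closedBall (Y a) (5 * R a)) := measure_biUnion_le _ hIc _
      _ ≤ ∑' a : I, ENNReal.ofReal (5 ^ d * (2 / μ)) * volume (ball (Y a) (R a) \ E) :=
          ENNReal.tsum_le_tsum fun a => hball a a.2
      _ = ENNReal.ofReal (5 ^ d * (2 / μ)) * ∑' a : I, volume (ball (Y a) (R a) \ E) :=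
          ENNReal.tsum_mul_left
      _ = ENNReal.ofReal (5 ^ d * (2 / μ)) * volume (⋃ a ∈ I, ball (Y a) (R a) \ E) := by
          rw [measure_biUnion hIc]
          · intro a ha b hb hab
            exact (hdis ha hb hab).mono (diff_subset.trans ball_subset_closedBall)
              (diff_subset.trans ball_subset_closedBall)
          · exact fun a _ => measurableSet_ball.diff hE.measurableSet
      _ ≤ _ := by
          gcongr
          exact iUnion₂_subset fun a ha => diff_subset_diff_left (hYR a (hIE ha)).2.2.2.1
  have hdf : volume (F \ E) ≠ ⊤ := ((measure_mono diff_subset).trans_lt hFfin.lt_top).ne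
  have h2 := measureReal_diff_add_inter (μ := volume) (s := F) hE.measurableSet hFfin
  rw [inter_eq_right.2 hEF] at h2
  have h3 : volume.real F - volume.real E = volume.real (F \ E) := by linarith
  rw [h3]
  have h4 := ENNReal.toReal_mono (ENNReal.mul_ne_top ENNReal.ofReal_ne_top hdf) hsum
  rwa [ENNReal.toReal_mul, ENNReal.toReal_ofReal (by positivity)] at h4

lemma f_scale {d : ℕ} {ρ s : ℝ} (hρ : 0 < ρ) (hs : 0 < s) (hρ1 : ρ ≤ 1) (x0 : Ed d) (f : Ed d → ℝ)
    (hsub : ball x0 (2 * ρ) ⊆ ball 0 2) :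
    ∫⁻ y in ball (0 : Ed d) 2, ENNReal.ofReal |s * ρ ^ 2 * f (x0 + ρ • y)| ^ d ≤
      ENNReal.ofReal s ^ d * ∫⁻ x in ball (0 : Ed d) 2, ENNReal.ofReal |f x| ^ d := by
  have e : ∀ y : Ed d, ENNReal.ofReal |s * ρ ^ 2 * f (x0 + ρ • y)| ^ d =
      ENNReal.ofReal (s * ρ) ^ d * (ENNReal.ofReal ρ ^ d * ENNReal.ofReal |f (x0 + ρ • y)| ^ d) := by
    intro y
    rw [← mul_pow, ← mul_pow, ← ENNReal.ofReal_mul hρ.le, ← ENNReal.ofReal_mul (by positivity),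
      abs_mul, abs_of_pos (by positivity : 0 < s * ρ ^ 2)]
    congr 2
    ring
  simp_rw [e]
  rw [lintegral_const_mul' _ _ (ENNReal.pow_ne_top ENNReal.ofReal_ne_top),
    lintegral_const_mul' _ _ (ENNReal.pow_ne_top ENNReal.ofReal_ne_top),
    ← setLIntegral_scale hρ x0 2 (fun x => ENNReal.ofReal |f x| ^ d)]
  refine mul_le_mul' ?_ (lintegral_mono_set hsub)
  gcongr
  exact mul_le_of_le_one_right hs.le hρ1

lemma ball_sub_two {d : ℕ} {y : Ed d} {t : ℝ} (h : ‖y‖ + 2 * t ≤ 2) :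
    ball y (2 * t) ⊆ ball (0 : Ed d) 2 := by
  apply ball_subset_ball'
  rw [dist_zero_right]; linarith

lemma map_ball {d : ℕ} {y : Ed d} {t : ℝ} (ht : 0 < t) (R : ℝ) (w : Ed d) :
    y + t • w ∈ ball y (R * t) ↔ w ∈ ball (0 : Ed d) R := by
  rw [mem_ball, mem_ball, dist_zero_right, dist_eq_norm, add_sub_cancel_left, norm_smul,
      Real.norm_of_nonneg ht.le, mul_comm, mul_lt_mul_iff_left₀ ht]

lemma cont_scale {d : ℕ} {f : Ed d → ℝ} {x0 : Ed d} {ρ : ℝ} (hρ : 0 < ρ) {O : Set (Ed d)}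
    (hf : ContinuousOn f O) (R : ℝ) (hsub : ball x0 (R * ρ) ⊆ O) (s : ℝ) :
    ContinuousOn (fun y => s * f (x0 + ρ • y)) (ball 0 R) := by
  refine continuousOn_const.mul (hf.comp (by fun_prop) ?_)
  intro y hy
  exact hsub ((map_ball hρ R y).2 hy)

lemma real_volume_scale {d : ℕ} {ρ : ℝ} (hρ : 0 < ρ) (x0 : Ed d) (S : Set (Ed d)) :
    volume.real S = ρ ^ d * volume.real {y | x0 + ρ • y ∈ S} := by
  rw [measureReal_def, volume_scale hρ x0 S, ENNReal.toReal_mul, ENNReal.toReal_pow,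
    ENNReal.toReal_ofReal hρ.le, measureReal_def]

lemma decay {d : ℕ} (hd : 1 ≤ d) {lam Lam C0 : ℝ} (hlam : 0 < lam) (hLam : lam ≤ Lam)
    (hC0 : 0 ≤ C0) {K : Ed d → ℝ} (hK : KernCond K) :
    ∃ r0 ε0 ε C : ℝ, 0 < r0 ∧ r0 ≤ 1 ∧ 0 < ε0 ∧ 0 < ε ∧ 0 < C ∧
      ∀ r, 0 < r → r ≤ r0 → ∀ f u : Ed d → ℝ, ContinuousOn f (ball 0 2) →
        LowerSemicontinuous u → (∀ x, 0 ≤ u x) →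
        SupersolExtremal lam Lam C0 r K f (Metric.ball 0 2) u →
        (∫⁻ z in ball (0 : Ed d) 2, ENNReal.ofReal |f z| ^ d) ≤ ENNReal.ofReal ε0 →
        (∃ x, ‖x‖ ≤ 1 ∧ u x ≤ 1) →
        ∀ t, 0 < t → volume.real ({x | t < u x} ∩ ball (0 : Ed d) 1) ≤ C * t ^ (-ε) := by
  obtain ⟨r0, ε0, M, μ0, hr0, hr01, hε0, hM, hμ0, hkey⟩ := key_meas hd hlam hLam hC0 hK
  set V := volume.real (ball (0 : Ed d) 1) with hV
  have hVp : 0 < V := measureReal_ball_pos _ _ one_pos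
  set μ := min (μ0 / V) (1 / 2) with hμ
  have hμp : 0 < μ := by positivity
  have hμ1 : μ < 1 := (min_le_right _ _).trans_lt (by norm_num)
  have hM0 : 0 < M := by linarith
  set Q : ℝ := 5 ^ d * (2 / μ) with hQ
  have hQp : 0 < Q := by positivity
  set θ := Q / (1 + Q) with hθ
  have hθp : 0 < θ := by positivity
  have hθ1 : θ < 1 := by rw [hθ, div_lt_one (by positivity)]; linarith
  set ε := -Real.log θ / Real.log M with hε
  have hlM : 0 < Real.log M := Real.log_pos hM
  have hεp : 0 < ε := div_pos (neg_pos.2 (Real.log_neg hθp hθ1)) hlM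
  have hMθ : M ^ (-ε) = θ := by
    rw [Real.rpow_def_of_pos hM0, hε]
    rw [show Real.log M * -(-Real.log θ / Real.log M) = Real.log θ by field_simp, Real.exp_log hθp]
  refine ⟨r0, ε0, ε, V / θ, hr0, hr01, hε0, hεp, by positivity, ?_⟩
  intro r hr hrr f u hf hlsc hu0 hu hfi hx
  have hdens : ∀ s, 1 ≤ s → ∀ (y : Ed d) (t : ℝ), 0 < t → ‖y‖ + t ≤ 1 →
      (∃ z, ‖z - y‖ ≤ t ∧ u z ≤ s) →
      volume.real ({x | M * s < u x} ∩ ball y t) ≤ (1 - μ) * volume.real (ball y t) := by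
    rintro s hs y t ht hyt ⟨z, hz, huz⟩
    have hs0 : 0 < s := by linarith
    have ht1 : t ≤ 1 := by linarith [norm_nonneg y]
    have hsub : ball y (2 * t) ⊆ ball (0 : Ed d) 2 := ball_sub_two (by linarith [norm_nonneg y])
    have hsc := supersol_scale (s := s⁻¹) hr ht (inv_pos.2 hs0) y (O' := ball 0 2)
      (fun w hw => hsub ((map_ball ht 2 w).2 hw)) hu
    have h := hkey (r * t) (by positivity) ((mul_le_of_le_one_right hr.le ht1).trans hrr) _ _
      (cont_scale ht hf 2 hsub (s⁻¹ * t ^ 2)) (lsc_scale hlsc (inv_pos.2 hs0) t y)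
      (fun x => mul_nonneg (inv_pos.2 hs0).le (hu0 _)) hsc
      (by
        refine (f_scale ht (inv_pos.2 hs0) ht1 y f hsub).trans ?_
        refine (mul_le_of_le_one_left' (pow_le_one' ?_ d)).trans hfi
        rw [ENNReal.ofReal_le_one]
        exact inv_le_one_of_one_le₀ hs)
      ⟨t⁻¹ • (z - y), by
        rw [norm_smul, Real.norm_of_nonneg (inv_pos.2 ht).le, inv_mul_le_iff₀ ht]; linarith, by
        rw [smul_smul, mul_inv_cancel₀ ht.ne', one_smul, add_sub_cancel, inv_mul_le_iff₀ hs0]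
        linarith⟩
    have hset : {w : Ed d | y + t • w ∈ {x | u x ≤ M * s} ∩ ball y t} =
        {x | s⁻¹ * u (y + t • x) ≤ M} ∩ ball (0 : Ed d) 1 := by
      ext w
      have := map_ball (y := y) ht 1 w
      rw [one_mul] at this
      constructor
      · rintro ⟨h1, h2⟩
        refine ⟨?_, this.1 h2⟩
        change s⁻¹ * u (y + t • w) ≤ M
        rw [inv_mul_le_iff₀ hs0, mul_comm]
        exact h1
      · rintro ⟨h1, h2⟩
        refine ⟨?_, this.2 h2⟩
        change s⁻¹ * u (y + t • w) ≤ M at h1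
        rw [inv_mul_le_iff₀ hs0, mul_comm] at h1
        exact h1
    have h2 : μ0 ≤ volume.real ({x | s⁻¹ * u (y + t • x) ≤ M} ∩ ball (0 : Ed d) 1) := by
      have := ENNReal.toReal_mono
        ((measure_mono inter_subset_right).trans_lt measure_ball_lt_top).ne h
      rwa [ENNReal.toReal_ofReal hμ0.le] at this
    rw [← hset] at h2
    have h3 := real_volume_scale ht y ({x | u x ≤ M * s} ∩ ball y t)
    have h4 : volume.real (ball y t) = t ^ d * V := real_ball y ht
    have h5 : μ * V ≤ μ0 := by
      have : μ ≤ μ0 / V := min_le_left _ _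
      rwa [le_div_iff₀ hVp] at this
    have hmeas : MeasurableSet {x | u x ≤ M * s} := (hlsc.isClosed_preimage (M * s)).measurableSet
    have h6 := measureReal_sdiff_add_inter (μ := volume) (s := ball y t) hmeas measure_ball_lt_top.ne
    have h7 : ball y t \ {x | u x ≤ M * s} = {x | M * s < u x} ∩ ball y t := by
      ext x
      simp only [mem_diff, mem_ofPred_eq, mem_inter_iff, not_le]
      tauto
    rw [h7, inter_comm (ball y t), h3] at h6
    have h8 : t ^ d * (μ * V) ≤ t ^ d * volume.real {w : Ed d | y + t • w ∈ {x | u x ≤ M * s} ∩ ball y t} := by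
      gcongr
      exact h5.trans h2
    rw [h4] at h6 ⊢
    linarith
  obtain ⟨xb, hxb, hub⟩ := hx
  set A : ℕ → Set (Ed d) := fun k => {x | M ^ k < u x} ∩ ball (0 : Ed d) 1 with hA
  have hstep : ∀ k, volume.real (A (k + 1)) ≤ θ * volume.real (A k) := by
    intro k
    have hMk : 1 ≤ M ^ k := one_le_pow₀ hM.le
    have hink := ink_spots (E := A (k + 1)) (F := A k) (μ := μ)
      ((hlsc.isOpen_preimage _).inter isOpen_ball) (by
        rintro x ⟨h1, h2⟩
        refine ⟨?_, h2⟩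
        exact lt_of_le_of_lt (pow_le_pow_right₀ hM.le (Nat.le_succ k)) h1) inter_subset_right
      hμp hμ1 (by
        have := hdens (M ^ k) hMk 0 1 one_pos (by simp) ⟨xb, by simpa using hxb, hub.trans hMk⟩
        simp only [hA, pow_succ']
        exact this) (by
        intro y t ht hyt hlt
        by_contra hcon
        rw [not_subset] at hcon
        obtain ⟨z, hz, hzA⟩ := hcon
        have hz1 : z ∈ ball (0 : Ed d) 1 :=
          ball_subset_ball' (by rw [dist_zero_right]; linarith) hz
        have huz : u z ≤ M ^ k := by
          by_contra h
          exact hzA ⟨not_le.1 h, hz1⟩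
        have := hdens (M ^ k) hMk y t ht hyt ⟨z, by
          rw [mem_ball, dist_eq_norm] at hz; exact hz.le, huz⟩
        have h2 : volume.real (A (k + 1) ∩ ball y t) ≤ volume.real ({x | M * M ^ k < u x} ∩ ball y t) := by
          apply measureReal_mono _ ((measure_mono inter_subset_right).trans_lt measure_ball_lt_top).ne
          rintro x ⟨⟨h1, _⟩, h3⟩
          refine ⟨?_, h3⟩
          rw [pow_succ'] at h1
          exact h1
        linarith)
    rw [← hQ] at hink
    rw [hθ, div_mul_eq_mul_div, le_div_iff₀ (by positivity)]
    linarith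
  have hpow : ∀ k, volume.real (A k) ≤ θ ^ k * V := by
    intro k
    induction k with
    | zero =>
      rw [pow_zero, one_mul]
      exact measureReal_mono inter_subset_right measure_ball_lt_top.ne
    | succ k ih =>
      refine (hstep k).trans ?_
      rw [pow_succ', mul_assoc]
      gcongr
  intro t ht
  rcases le_total t 1 with h1 | h1
  · have h2 : volume.real ({x | t < u x} ∩ ball (0 : Ed d) 1) ≤ V :=
      measureReal_mono inter_subset_right measure_ball_lt_top.ne
    have h3 : 1 ≤ t ^ (-ε) := Real.one_le_rpow_of_pos_of_le_one_of_nonpos ht h1 (by linarith)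
    have h4 : V ≤ V / θ := by rw [le_div_iff₀ hθp]; nlinarith
    nlinarith
  · obtain ⟨k, hk1, hk2⟩ := exists_nat_pow_near h1 hM
    have h2 : volume.real ({x | t < u x} ∩ ball (0 : Ed d) 1) ≤ volume.real (A k) := by
      apply measureReal_mono _ ((measure_mono inter_subset_right).trans_lt measure_ball_lt_top).ne
      rintro x ⟨h3, h4⟩
      exact ⟨lt_of_le_of_lt hk1 h3, h4⟩
    refine h2.trans ((hpow k).trans ?_)
    have h5 : θ ^ (k + 1) ≤ t ^ (-ε) := by
      calc θ ^ (k + 1) = (M ^ (k + 1)) ^ (-ε) := by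
            rw [← hMθ, ← Real.rpow_natCast, ← Real.rpow_natCast, ← Real.rpow_mul hM0.le,
              ← Real.rpow_mul hM0.le, mul_comm]
        _ ≤ t ^ (-ε) := Real.rpow_le_rpow_of_nonpos ht hk2.le (by linarith)
    calc θ ^ k * V = V / θ * θ ^ (k + 1) := by rw [pow_succ]; field_simp
      _ ≤ _ := by gcongr

lemma local_est {d : ℕ} (hd : 1 ≤ d) {lam Lam C0 : ℝ} (hlam : 0 < lam) (hLam : lam ≤ Lam)
    (hC0 : 0 ≤ C0) {K : Ed d → ℝ} (hK : KernCond K) :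
    ∃ ρ ε C : ℝ, 0 < ρ ∧ 0 < ε ∧ 0 < C ∧
      ∀ r, 0 < r → r ≤ 1 → ∀ f u : Ed d → ℝ, ContinuousOn f (ball 0 2) →
        LowerSemicontinuous u → (∀ x, 0 ≤ u x) →
        SupersolExtremal lam Lam C0 r K f (Metric.ball 0 2) u →
        ∀ T, 0 < T →
        (∫⁻ z in ball (0 : Ed d) 2, ENNReal.ofReal |f z| ^ d) ≤ ENNReal.ofReal T ^ d →
        ∀ x, ‖x‖ ≤ 1 → (∃ z, ‖z - x‖ ≤ ρ ∧ u z ≤ T) →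
        ∀ t, 0 < t → volume.real ({x | t < u x} ∩ ball x ρ) ≤ C * (t / T) ^ (-ε) := by
  obtain ⟨r0, ε0, ε, C, hr0, hr01, hε0, hε, hC, hdec⟩ := decay hd hlam hLam hC0 hK
  set ρ := min r0 (1 / 2) with hρ
  have hρp : 0 < ρ := by positivity
  have hρ2 : ρ ≤ 1 / 2 := min_le_right _ _
  set A := max 1 ε0⁻¹ with hA
  have hA1 : 1 ≤ A := le_max_left _ _
  have hA0 : 0 < A := by linarith
  refine ⟨ρ, ε, C * A ^ ε, hρp, hε, by positivity, ?_⟩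
  intro r hr hr1 f u hf hlsc hu0 hu T hT hfi x hx hz t ht
  obtain ⟨z, hz, huz⟩ := hz
  set s := (A * T)⁻¹ with hs
  have hsp : 0 < s := by positivity
  have hsub : ball x (2 * ρ) ⊆ ball (0 : Ed d) 2 := ball_sub_two (by linarith)
  have hsc := supersol_scale (s := s) hr hρp hsp x (O' := ball 0 2)
      (fun w hw => hsub ((map_ball hρp 2 w).2 hw)) hu
  have h := hdec (r * ρ) (by positivity)
      ((mul_le_of_le_one_left hρp.le hr1).trans (min_le_left _ _)) _ _
      (cont_scale hρp hf 2 hsub (s * ρ ^ 2)) (lsc_scale hlsc hsp ρ x)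
      (fun x => mul_nonneg hsp.le (hu0 _)) hsc
      (by
        refine (f_scale hρp hsp (by linarith) x f hsub).trans ?_
        refine (mul_le_mul_right hfi _).trans ?_
        rw [← mul_pow, ← ENNReal.ofReal_mul hsp.le, ← ENNReal.ofReal_pow (by positivity)]
        apply ENNReal.ofReal_le_ofReal
        have e : s * T = A⁻¹ := by rw [hs]; field_simp
        rw [e]
        refine (pow_le_of_le_one (by positivity) (inv_le_one_of_one_le₀ hA1) (by omega)).trans ?_
        rw [inv_le_comm₀ hA0 hε0]
        exact le_max_right _ _)
      ⟨ρ⁻¹ • (z - x), by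
        rw [norm_smul, Real.norm_of_nonneg (inv_pos.2 hρp).le, inv_mul_le_iff₀ hρp]; linarith, by
        rw [smul_smul, mul_inv_cancel₀ hρp.ne', one_smul, add_sub_cancel, hs,
          inv_mul_le_iff₀ (by positivity)]
        nlinarith⟩ (s * t) (by positivity)
  have hset : {w : Ed d | x + ρ • w ∈ {x | t < u x} ∩ ball x ρ} =
      {y | s * t < s * u (x + ρ • y)} ∩ ball (0 : Ed d) 1 := by
    ext w
    have := map_ball (y := x) hρp 1 w
    rw [one_mul] at this
    constructor
    · rintro ⟨h1, h2⟩
      exact ⟨mul_lt_mul_of_pos_left h1 hsp, this.1 h2⟩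
    · rintro ⟨h1, h2⟩
      exact ⟨lt_of_mul_lt_mul_left h1 hsp.le, this.2 h2⟩
  rw [real_volume_scale hρp x, hset]
  have h2 : (s * t) ^ (-ε) = A ^ ε * (t / T) ^ (-ε) := by
    rw [show s * t = A⁻¹ * (t / T) by rw [hs]; field_simp,
      Real.mul_rpow (by positivity) (by positivity), Real.inv_rpow hA0.le, Real.rpow_neg hA0.le,
      inv_inv]
  rw [h2, ← mul_assoc] at h
  refine le_trans ?_ h
  exact mul_le_of_le_one_left measureReal_nonneg (pow_le_one₀ hρp.le (by linarith))

lemma unit_est {d : ℕ} (hd : 1 ≤ d) {lam Lam C0 : ℝ} (hlam : 0 < lam) (hLam : lam ≤ Lam)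
    (hC0 : 0 ≤ C0) {K : Ed d → ℝ} (hK : KernCond K) :
    ∃ ε C : ℝ, 0 < ε ∧ 0 < C ∧
      ∀ r, 0 < r → r ≤ 1 → ∀ f u : Ed d → ℝ, ContinuousOn f (ball 0 2) →
        LowerSemicontinuous u → (∀ x, 0 ≤ u x) →
        SupersolExtremal lam Lam C0 r K f (Metric.ball 0 2) u →
        ∀ T, 0 < T →
        (∫⁻ z in ball (0 : Ed d) 2, ENNReal.ofReal |f z| ^ d) ≤ ENNReal.ofReal T ^ d →
        (∃ z, ‖z‖ ≤ 1 ∧ u z ≤ T) →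
        ∀ t, 0 < t → volume.real ({x | t < u x} ∩ ball (0 : Ed d) 1) ≤ C * (t / T) ^ (-ε) := by
  obtain ⟨ρ, ε, C, hρ, hε, hC, hloc⟩ := local_est hd hlam hLam hC0 hK
  set v0 := volume.real (ball (0 : Ed d) (ρ / 2)) with hv0
  have hv0p : 0 < v0 := measureReal_ball_pos _ _ (by positivity)
  -- the constant of one step
  obtain ⟨L, hL1, hL⟩ : ∃ L : ℝ, 1 ≤ L ∧ C * L ^ (-ε) < v0 := by
    have h1 := (tendsto_rpow_neg_atTop hε).const_mul C
    rw [mul_zero] at h1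
    have h2 := (h1.eventually (gt_mem_nhds hv0p)).and (Filter.eventually_ge_atTop (1:ℝ))
    obtain ⟨L, h3, h4⟩ := h2.exists
    exact ⟨L, h4, h3⟩
  have hL0 : 0 < L := by linarith
  obtain ⟨N, hN⟩ := exists_nat_gt (2 / ρ)
  have hN0 : (0:ℝ) < N := lt_trans (by positivity) hN
  obtain ⟨t, htsub, htf, htcov⟩ := (isCompact_closedBall (0 : Ed d) 1).finite_cover_balls hρ
  set n := htf.toFinset.card with hn
  refine ⟨ε, (n + 1) * (C * (L ^ N) ^ ε), hε, by positivity, ?_⟩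
  intro r hr hr1 f u hf hlsc hu0 hu T hT hfi hz τ hτ
  obtain ⟨xb, hxb, hub⟩ := hz
  have hLk : ∀ k : ℕ, 1 ≤ L ^ k := fun k => one_le_pow₀ hL1
  have hfk : ∀ k : ℕ, (∫⁻ z in ball (0 : Ed d) 2, ENNReal.ofReal |f z| ^ d) ≤
      ENNReal.ofReal (L ^ k * T) ^ d := by
    intro k
    refine hfi.trans ?_
    gcongr
    exact le_mul_of_one_le_left hT.le (hLk k)
  have hstep : ∀ k : ℕ, ∀ x0 x1 : Ed d, ‖x0‖ ≤ 1 → ‖x1 - x0‖ ≤ ρ →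
      (∃ z, ‖z - x0‖ ≤ ρ ∧ u z ≤ L ^ k * T) → (∃ z, ‖z - x1‖ ≤ ρ ∧ u z ≤ L ^ (k + 1) * T) := by
    intro k x0 x1 hx0 hx01 hz
    have hT' : 0 < L ^ k * T := by positivity
    have h1 := hloc r hr hr1 f u hf hlsc hu0 hu (L ^ k * T) hT' (hfk k) x0 hx0 hz (L ^ (k + 1) * T)
      (by positivity)
    have e : L ^ (k + 1) * T / (L ^ k * T) = L := by rw [pow_succ]; field_simp
    rw [e] at h1
    by_contra hcon
    push Not at hcon
    set y := x0 + (1 / 2 : ℝ) • (x1 - x0) with hy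
    have hy0 : dist y x0 ≤ ρ / 2 := by
      rw [dist_eq_norm, hy, add_sub_cancel_left, norm_smul, Real.norm_of_nonneg (by norm_num)]
      linarith
    have hy1 : dist y x1 ≤ ρ / 2 := by
      have e2 : y - x1 = (-(1 / 2 : ℝ)) • (x1 - x0) := by rw [hy]; module
      rw [dist_eq_norm, e2, norm_smul, norm_neg, Real.norm_of_nonneg (by norm_num)]
      linarith
    have hsub : ball y (ρ / 2) ⊆ {x | L ^ (k + 1) * T < u x} ∩ ball x0 ρ := by
      intro z hz
      refine ⟨?_, ball_subset_ball' (by linarith) hz⟩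
      apply hcon
      have : z ∈ ball x1 ρ := ball_subset_ball' (by linarith) hz
      rw [mem_ball, dist_eq_norm] at this
      exact this.le
    have h2 := measureReal_mono hsub
      ((measure_mono inter_subset_right).trans_lt (measure_ball_lt_top (μ := volume))).ne
    have h3 : volume.real (ball y (ρ / 2)) = v0 := by
      rw [hv0, real_ball y (by positivity : 0 < ρ / 2)]
      exact (real_ball (0 : Ed d) (by positivity : 0 < ρ / 2)).symm
    linarith
  have hchain : ∀ x : Ed d, ‖x‖ ≤ 1 → ∀ k : ℕ, k ≤ N →
      ∃ z, ‖z - (xb + ((k : ℝ) / N) • (x - xb))‖ ≤ ρ ∧ u z ≤ L ^ k * T := by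
    intro x hx k
    induction k with
    | zero =>
      intro _
      exact ⟨xb, by simp; exact hρ.le, by simpa using hub⟩
    | succ k ih =>
      intro hk
      refine hstep k _ _ ?_ ?_ (ih (by omega))
      · have hkN : (k : ℝ) / N ≤ 1 := by
          rw [div_le_one hN0]; exact_mod_cast (by omega : k ≤ N)
        have hk0 : 0 ≤ (k : ℝ) / N := by positivity
        have e : xb + ((k : ℝ) / N) • (x - xb) = (1 - (k : ℝ) / N) • xb + ((k : ℝ) / N) • x := by module
        rw [e]
        refine (norm_add_le _ _).trans ?_
        rw [norm_smul, norm_smul, Real.norm_of_nonneg hk0, Real.norm_of_nonneg (by linarith)]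
        nlinarith [norm_nonneg x, norm_nonneg xb]
      · have e : xb + (((k + 1 : ℕ) : ℝ) / N) • (x - xb) - (xb + ((k : ℝ) / N) • (x - xb)) =
            (1 / N : ℝ) • (x - xb) := by
          rw [add_sub_add_left_eq_sub, ← sub_smul]
          congr 1
          push_cast
          ring
        rw [e, norm_smul, Real.norm_of_nonneg (by positivity)]
        have h1 : ‖x - xb‖ ≤ 2 := (norm_sub_le _ _).trans (by linarith)
        rw [div_lt_iff₀ hρ] at hN
        rw [one_div, inv_mul_le_iff₀ hN0]
        linarith
  have hball : ∀ x ∈ t, volume.real ({x | τ < u x} ∩ ball x ρ) ≤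
      C * (L ^ N) ^ ε * (τ / T) ^ (-ε) := by
    intro x hxt
    have hx : ‖x‖ ≤ 1 := by simpa using htsub hxt
    have h1 := hchain x hx N le_rfl
    rw [div_self hN0.ne', one_smul, add_sub_cancel] at h1
    have h2 := hloc r hr hr1 f u hf hlsc hu0 hu (L ^ N * T) (by positivity) (hfk N) x hx h1 τ hτ
    have e : (τ / (L ^ N * T)) ^ (-ε) = (L ^ N) ^ ε * (τ / T) ^ (-ε) := by
      rw [show τ / (L ^ N * T) = (L ^ N)⁻¹ * (τ / T) by field_simp,
        Real.mul_rpow (by positivity) (by positivity), Real.inv_rpow (by positivity),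
        Real.rpow_neg (by positivity), inv_inv]
    rw [e, ← mul_assoc] at h2
    exact h2
  have hcov : {x | τ < u x} ∩ ball (0 : Ed d) 1 ⊆ ⋃ x ∈ htf.toFinset, ({x | τ < u x} ∩ ball x ρ) := by
    rintro y ⟨h1, h2⟩
    have := htcov (ball_subset_closedBall h2)
    rw [mem_iUnion₂] at this ⊢
    obtain ⟨x, hx, hy⟩ := this
    exact ⟨x, htf.mem_toFinset.2 hx, h1, hy⟩
  set c := C * (L ^ N) ^ ε * (τ / T) ^ (-ε) with hc
  have hcp : 0 ≤ c := by positivity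
  calc volume.real ({x | τ < u x} ∩ ball (0 : Ed d) 1)
      ≤ volume.real (⋃ x ∈ htf.toFinset, ({x | τ < u x} ∩ ball x ρ)) := by
        refine measureReal_mono hcov ?_
        refine ((measure_biUnion_finset_le _ _).trans_lt ?_).ne
        exact ENNReal.sum_lt_top.2 fun x _ =>
          (measure_mono inter_subset_right).trans_lt measure_ball_lt_top
    _ ≤ ∑ x ∈ htf.toFinset, volume.real ({x | τ < u x} ∩ ball x ρ) :=
        measureReal_biUnion_finset_le _ _
    _ ≤ ∑ x ∈ htf.toFinset, c := Finset.sum_le_sum fun x hx => hball x (htf.mem_toFinset.1 hx)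
    _ = n * c := by rw [Finset.sum_const, nsmul_eq_mul]
    _ ≤ (n + 1) * c := by gcongr; linarith
    _ = _ := by rw [hc]; ring

/-- weak Harnack distribution estimate on balls (Corollary 3.11). -/
theorem weak_harnack_distribution {d : ℕ} (hd : 1 ≤ d) (lam Lam C0 : ℝ)
    (hlam : 0 < lam) (hLam : lam ≤ Lam) (hC0 : 0 ≤ C0)
    (K : Ed d → ℝ) (hK : KernCond K) :
    ∃ ε₃ C : ℝ, 0 < ε₃ ∧ 0 < C ∧
      ∀ r : ℝ, 0 < r → r ≤ 1 → ∀ l : ℝ, 0 < l → l ≤ 1 →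
      ∀ f : Ed d → ℝ, ContinuousOn f (Metric.ball (0 : Ed d) (2 * l)) →
        IntegrableOn (fun x => |f x| ^ (d : ℝ)) (Metric.ball (0 : Ed d) (2 * l)) →
      ∀ u : Ed d → ℝ, LowerSemicontinuous u → IsBddFun u → (∀ x, 0 ≤ u x) →
        SupersolExtremal lam Lam C0 r K f (Metric.ball (0 : Ed d) (2 * l)) u →
        ∀ t : ℝ, 0 < t →
          volume {x ∈ Metric.ball (0 : Ed d) l | t < u x} ≤
            ENNReal.ofReal (C * l ^ (d : ℝ) *
              (sInf (u '' Metric.ball (0 : Ed d) l) +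
                l * LnormOn (d : ℝ) (Metric.ball (0 : Ed d) (2 * l)) f) ^ ε₃ * t ^ (-ε₃)) := by
  obtain ⟨ε, C, hε, hC, hunit⟩ := unit_est hd hlam hLam hC0 hK
  refine ⟨ε, C, hε, hC, ?_⟩
  intro r hr hr1 l hl hl1 f hfc hfi u hlsc hub hu0 hsup t ht
  set N := LnormOn (d : ℝ) (Metric.ball (0 : Ed d) (2 * l)) f with hN
  set I := sInf (u '' Metric.ball (0 : Ed d) l) with hI
  have hd0 : (d : ℝ) ≠ 0 := by
    have : d ≠ 0 := by omega
    exact_mod_cast this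
  have hint0 : 0 ≤ ∫ x in Metric.ball (0 : Ed d) (2 * l), |f x| ^ (d : ℝ) :=
    integral_nonneg fun x => Real.rpow_nonneg (abs_nonneg _) _
  have hN0 : 0 ≤ N := Real.rpow_nonneg hint0 _
  have hNd : N ^ d = ∫ x in Metric.ball (0 : Ed d) (2 * l), |f x| ^ (d : ℝ) := by
    rw [hN, LnormOn, ← Real.rpow_natCast, ← Real.rpow_mul hint0, one_div,
      inv_mul_cancel₀ hd0, Real.rpow_one]
  have hNl : (∫⁻ x in Metric.ball (0 : Ed d) (2 * l), ENNReal.ofReal |f x| ^ d)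
      = ENNReal.ofReal N ^ d := by
    rw [← ENNReal.ofReal_pow hN0, hNd, ofReal_integral_eq_lintegral_ofReal hfi
      (Filter.Eventually.of_forall fun x => Real.rpow_nonneg (abs_nonneg _) _)]
    refine lintegral_congr fun x => ?_
    rw [Real.rpow_natCast, ENNReal.ofReal_pow (abs_nonneg _)]
  have hfl : (∫⁻ z in Metric.ball (0 : Ed d) 2, ENNReal.ofReal |1 * l ^ 2 * f (0 + l • z)| ^ d)
      = ENNReal.ofReal (l * N) ^ d := by
    have h1 : ∀ z : Ed d, ENNReal.ofReal |1 * l ^ 2 * f (0 + l • z)| ^ d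
        = (ENNReal.ofReal l ^ d * ENNReal.ofReal l ^ d) * ENNReal.ofReal |f (0 + l • z)| ^ d := by
      intro z
      rw [one_mul, abs_mul, abs_of_pos (by positivity : 0 < l ^ 2),
        ENNReal.ofReal_mul (by positivity), mul_pow, sq, ENNReal.ofReal_mul hl.le, mul_pow]
    simp_rw [h1]
    have hfin : ENNReal.ofReal l ^ d * ENNReal.ofReal l ^ d ≠ ⊤ :=
      ENNReal.mul_ne_top (ENNReal.pow_ne_top ENNReal.ofReal_ne_top)
        (ENNReal.pow_ne_top ENNReal.ofReal_ne_top)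
    rw [lintegral_const_mul' _ _ hfin, mul_assoc,
      ← setLIntegral_scale hl (0 : Ed d) 2 (fun x => ENNReal.ofReal |f x| ^ d), hNl,
      ENNReal.ofReal_mul hl.le, mul_pow]
  have hne : (u '' Metric.ball (0 : Ed d) l).Nonempty := ⟨u 0, 0, mem_ball_self hl, rfl⟩
  have hI0 : 0 ≤ I := le_csInf hne (by rintro _ ⟨x, -, rfl⟩; exact hu0 x)
  have hsup' := supersol_scale (s := 1) hr hl one_pos (0 : Ed d) (O' := Metric.ball (0 : Ed d) 2)
    (fun y hy => (map_ball hl 2 y).2 hy) hsup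
  have hfin : volume {x ∈ Metric.ball (0 : Ed d) l | t < u x} ≠ ⊤ :=
    ((measure_mono (fun x hx => hx.1)).trans_lt
      (measure_ball_lt_top (μ := volume) (x := (0 : Ed d)) (r := l))).ne
  have key : ∀ η : ℝ, 0 < η → volume.real {x ∈ Metric.ball (0 : Ed d) l | t < u x}
      ≤ C * l ^ (d : ℝ) * (I + l * N + η) ^ ε * t ^ (-ε) := by
    intro η hη
    have hlN : 0 ≤ l * N := mul_nonneg hl.le hN0
    have hT : 0 < I + l * N + η := by linarith
    have hex : ∃ z : Ed d, ‖z‖ ≤ 1 ∧ (1 : ℝ) * u (0 + l • z) ≤ I + l * N + η := by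
      obtain ⟨_, ⟨x, hx, rfl⟩, hlt⟩ := exists_lt_of_csInf_lt hne
        (show sInf (u '' Metric.ball (0 : Ed d) l) < I + η by linarith)
      refine ⟨l⁻¹ • x, ?_, ?_⟩
      · rw [mem_ball, dist_zero_right] at hx
        rw [norm_smul, Real.norm_of_nonneg (by positivity), inv_mul_le_iff₀ hl]
        linarith
      · rw [smul_smul, mul_inv_cancel₀ hl.ne', one_smul, zero_add, one_mul]
        linarith
    have h := hunit (r * l) (mul_pos hr hl) (mul_le_one₀ hr1 hl.le hl1) _ _
      (cont_scale hl hfc 2 subset_rfl (1 * l ^ 2)) (lsc_scale hlsc one_pos l 0)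
      (fun x => by simpa using hu0 _) hsup' (I + l * N + η) hT
      (hfl.le.trans (by gcongr; linarith)) hex t ht
    rw [real_volume_scale hl (0 : Ed d)]
    have hset : {y : Ed d | 0 + l • y ∈ {x ∈ Metric.ball (0 : Ed d) l | t < u x}}
        = {x | t < 1 * u (0 + l • x)} ∩ Metric.ball (0 : Ed d) 1 := by
      ext y
      have := map_ball (y := (0 : Ed d)) hl 1 y
      rw [one_mul] at this
      simp only [mem_setOf_eq, mem_inter_iff, this, one_mul]
      exact and_comm
    rw [hset]
    have hpow : (t / (I + l * N + η)) ^ (-ε) = (I + l * N + η) ^ ε * t ^ (-ε) := by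
      rw [Real.div_rpow ht.le hT.le, Real.rpow_neg hT.le, div_inv_eq_mul, mul_comm]
    rw [hpow] at h
    calc _ ≤ l ^ d * (C * ((I + l * N + η) ^ ε * t ^ (-ε))) := by gcongr
      _ = _ := by rw [Real.rpow_natCast]; ring
  have hlim : Filter.Tendsto (fun η : ℝ => C * l ^ (d : ℝ) * (I + l * N + η) ^ ε * t ^ (-ε))
      (nhdsWithin 0 (Ioi 0)) (nhds (C * l ^ (d : ℝ) * (I + l * N) ^ ε * t ^ (-ε))) := by
    have hc : Continuous (fun η : ℝ => C * l ^ (d : ℝ) * (I + l * N + η) ^ ε * t ^ (-ε)) :=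
      ((continuous_const.mul ((continuous_const.add continuous_id).rpow_const
        (fun _ => Or.inr hε.le))).mul continuous_const)
    have := hc.tendsto 0
    rw [add_zero] at this
    exact this.mono_left nhdsWithin_le_nhds
  have hfinal := ge_of_tendsto hlim
    (Filter.eventually_of_mem self_mem_nhdsWithin (fun η hη => key η hη))
  rw [← ENNReal.ofReal_toReal hfin]
  exact ENNReal.ofReal_le_ofReal hfinal
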